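/- arXiv:2012.01161 — 3 statements merged into one kernel-verified Lean document; each statement's English description precedes it below -/
import Mathlib

section
/- For every α > (ln 2)/π, ∫_0^{π/2} (cos 2x · sin(ln(2 cos x)/α)) / (cosh(x/α) + cos(ln(2 cos x)/α)) dx = π/(8α) - πα/(4 sinh(πα)) - (πα/8)·Σ_{n=0}^∞ 1/sinh²(πα(2n+1)/2). -/
open Real

/-- The conjugate pair of simple poles `(1 / (p - u) - 1 / (p + u)) / 2`. -/
noncomputable def polePair (p : ℝ) (u : ℂ) : ℂ := u / ((p : ℂ) ^ 2 - u ^ 2)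

/-- The principal branch of `log (1 + z)`. -/
noncomputable def logOneAdd (z : ℂ) : ℂ := Complex.log (1 + z)

/-- The regular part `(z - w) / z * polePair p (logOneAdd z)`, where `w = exp (-p) - 1` is the pole
of `polePair p ∘ logOneAdd` in the unit disc, with its removable singularities filled in. -/
noncomputable def regularPart (p : ℝ) (z : ℂ) : ℂ :=
  dslope logOneAdd 0 z / ((p - logOneAdd z) * dslope logOneAdd (Real.exp (-p) - 1 : ℝ) z)

lemma one_add_mem_slitPlane {z : ℂ} (hz : ‖z‖ ≤ 1) (h : z ≠ -1) :
    1 + z ∈ Complex.slitPlane := by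
  rw [Complex.mem_slitPlane_iff]
  by_contra! hc
  simp only [Complex.add_re, Complex.one_re, Complex.add_im, Complex.one_im, zero_add] at hc
  have h1 : -1 ≤ z.re := by linarith [neg_abs_le z.re, Complex.abs_re_le_norm z]
  exact h (Complex.ext (by simp; linarith [hc.1]) (by simp [hc.2]))

lemma hasDerivAt_logOneAdd {z : ℂ} (hz : 1 + z ∈ Complex.slitPlane) :
    HasDerivAt logOneAdd (1 / (1 + z)) z :=
  ((hasDerivAt_id z).const_add 1).clog hz

lemma logOneAdd_re_le {z : ℂ} (hz : ‖z‖ ≤ 1) : (logOneAdd z).re ≤ Real.log 2 := by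
  rw [logOneAdd, Complex.log_re]
  rcases eq_or_ne (1 + z) 0 with h | h
  · simpa [h] using Real.log_nonneg one_le_two
  · refine Real.log_le_log (norm_pos_iff.2 h) ((norm_add_le _ _).trans ?_)
    rw [norm_one]; linarith

lemma logOneAdd_zero : logOneAdd 0 = 0 := by simp [logOneAdd]

lemma logOneAdd_neg_one : logOneAdd (-1) = 0 := by simp [logOneAdd]

lemma one_add_exp_neg_sub_one (p : ℝ) :
    (1 : ℂ) + (Real.exp (-p) - 1 : ℝ) = (Real.exp (-p) : ℝ) := by
  push_cast; ring

lemma logOneAdd_exp_neg_sub_one (p : ℝ) : logOneAdd (Real.exp (-p) - 1 : ℝ) = -p := by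
  rw [logOneAdd, one_add_exp_neg_sub_one, ← Complex.ofReal_log (Real.exp_pos _).le, Real.log_exp]
  simp

lemma regularPart_eq (p : ℝ) {z : ℂ} (h0 : z ≠ 0) (hz : z ≠ (Real.exp (-p) - 1 : ℝ)) :
    regularPart p z =
      (z - (Real.exp (-p) - 1 : ℝ)) / z * polePair p (logOneAdd z) := by
  have : (p : ℂ) ^ 2 - logOneAdd z ^ 2 = (p - logOneAdd z) * (logOneAdd z + p) := by ring
  rw [regularPart, polePair, dslope_of_ne _ h0, dslope_of_ne _ hz, slope_def_field, slope_def_field,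
    logOneAdd_zero, logOneAdd_exp_neg_sub_one, this]
  simp only [div_eq_mul_inv, mul_inv, inv_inv, sub_zero, sub_neg_eq_add]
  ring

lemma tendsto_logOneAdd_re :
    Filter.Tendsto (fun z => (logOneAdd z).re) (nhdsWithin (-1) {-1}ᶜ) Filter.atBot := by
  simp only [logOneAdd, Complex.log_re]
  refine Real.tendsto_log_nhdsGT_zero.comp (tendsto_nhdsWithin_iff.2 ⟨?_, ?_⟩)
  · have : Continuous fun z : ℂ => ‖1 + z‖ := by fun_prop
    simpa using (this.tendsto (-1)).mono_left nhdsWithin_le_nhds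
  · filter_upwards [self_mem_nhdsWithin] with z hz
    have hz : z ≠ -1 := hz
    exact norm_pos_iff.2 fun h => hz (by linear_combination h)

lemma tendsto_polePair_cobounded (p : ℝ) :
    Filter.Tendsto (polePair p) (Bornology.cobounded ℂ) (nhds 0) := by
  have h : Filter.Tendsto (fun u : ℂ => u⁻¹) (Bornology.cobounded ℂ) (nhds 0) :=
    Filter.tendsto_inv₀_cobounded
  have h2 : Filter.Tendsto (fun u : ℂ => u⁻¹ / ((p : ℂ) ^ 2 * (u⁻¹) ^ 2 - 1))
      (Bornology.cobounded ℂ) (nhds (0 / ((p : ℂ) ^ 2 * 0 ^ 2 - 1))) :=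
    h.div (((h.pow 2).const_mul _).sub_const 1) (by simp)
  rw [zero_div] at h2
  refine h2.congr' ?_
  filter_upwards [Bornology.eventually_ne_cobounded (0 : ℂ)] with u hu
  rw [polePair, ← mul_div_mul_left _ _ (pow_ne_zero 2 hu)]
  congr 1 <;> field_simp

lemma continuousAt_regularPart_neg_one (p : ℝ) : ContinuousAt (regularPart p) (-1) := by
  have hne : (-1 : ℂ) ≠ (Real.exp (-p) - 1 : ℝ) := by
    intro h
    have := congrArg Complex.re h
    simp only [Complex.neg_re, Complex.one_re, Complex.ofReal_re] at this
    linarith [Real.exp_pos (-p)]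
  rw [continuousAt_iff_punctured_nhds,
    regularPart_eq p (by norm_num) hne, logOneAdd_neg_one]
  have hcob : Filter.Tendsto logOneAdd (nhdsWithin (-1) {-1}ᶜ) (Bornology.cobounded ℂ) := by
    rw [← tendsto_norm_atTop_iff_cobounded]
    refine Filter.tendsto_atTop_mono (fun z => ?_)
      (Filter.tendsto_neg_atBot_atTop.comp tendsto_logOneAdd_re)
    exact (neg_le_abs _).trans (Complex.abs_re_le_norm _)
  have h1 : Filter.Tendsto (fun z : ℂ => (z - (Real.exp (-p) - 1 : ℝ)) / z)
      (nhdsWithin (-1) {-1}ᶜ) (nhds ((-1 - (Real.exp (-p) - 1 : ℝ)) / -1)) := by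
    refine Filter.Tendsto.mono_left ?_ nhdsWithin_le_nhds
    exact (continuousAt_id.sub continuousAt_const).div continuousAt_id (by simp)
  have h2 := h1.mul ((tendsto_polePair_cobounded p).comp hcob)
  simp only [polePair, zero_div]
  refine h2.congr' ?_
  filter_upwards [nhdsWithin_le_nhds (isOpen_ne.mem_nhds (show (-1 : ℂ) ≠ 0 by norm_num)),
    nhdsWithin_le_nhds (isOpen_ne.mem_nhds hne)] with z h0 hz
  exact (regularPart_eq p h0 hz).symm

lemma sub_logOneAdd_ne_zero {p : ℝ} (hp : Real.log 2 < p) {z : ℂ} (hz : ‖z‖ ≤ 1) :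
    (p : ℂ) - logOneAdd z ≠ 0 := by
  intro h
  have := congrArg Complex.re h
  simp only [Complex.sub_re, Complex.ofReal_re, Complex.zero_re] at this
  linarith [logOneAdd_re_le hz]

lemma exp_neg_sub_one_mem_ball {p : ℝ} (hp : 0 < p) :
    ((Real.exp (-p) - 1 : ℝ) : ℂ) ∈ Metric.ball (0 : ℂ) 1 := by
  rw [mem_ball_zero_iff, Complex.norm_real, Real.norm_eq_abs, abs_lt]
  have := Real.exp_lt_one_iff.2 (neg_lt_zero.2 hp)
  constructor <;> linarith [Real.exp_pos (-p)]

lemma exp_neg_sub_one_ne_zero {p : ℝ} (hp : 0 < p) : ((Real.exp (-p) - 1 : ℝ) : ℂ) ≠ 0 := by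
  have := Real.exp_lt_one_iff.2 (neg_lt_zero.2 hp)
  exact_mod_cast (by linarith : Real.exp (-p) - 1 < 0).ne

lemma deriv_logOneAdd_exp_neg_sub_one (p : ℝ) :
    deriv logOneAdd (Real.exp (-p) - 1 : ℝ) = 1 / (Real.exp (-p) : ℝ) := by
  rw [(hasDerivAt_logOneAdd _).deriv, one_add_exp_neg_sub_one]
  rw [one_add_exp_neg_sub_one, Complex.ofReal_mem_slitPlane]
  exact Real.exp_pos _

lemma dslope_logOneAdd_ne_zero (p : ℝ) {z : ℂ} (h : z ≠ -1) :
    dslope logOneAdd (Real.exp (-p) - 1 : ℝ) z ≠ 0 := by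
  rcases eq_or_ne z (Real.exp (-p) - 1 : ℝ) with rfl | hne
  · rw [dslope_same, deriv_logOneAdd_exp_neg_sub_one p]
    exact one_div_ne_zero (Complex.ofReal_ne_zero.2 (Real.exp_ne_zero _))
  · rw [dslope_of_ne _ hne, slope_def_field, logOneAdd_exp_neg_sub_one]
    refine div_ne_zero (fun h' => hne ?_) (sub_ne_zero.2 hne)
    have h1 : (1 : ℂ) + z ≠ 0 := fun h0 => h (by linear_combination h0)
    have h2 := Complex.exp_log h1
    rw [show Complex.log (1 + z) = (-p : ℝ) by
      rw [sub_neg_eq_add] at h'; push_cast; exact eq_neg_of_add_eq_zero_left h',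
      ← Complex.ofReal_exp] at h2
    push_cast at h2 ⊢
    linear_combination -h2

lemma continuousOn_regularPart {p : ℝ} (hp : Real.log 2 < p) :
    ContinuousOn (regularPart p) (Metric.closedBall 0 1) := by
  intro z hz
  rw [mem_closedBall_zero_iff] at hz
  refine ContinuousAt.continuousWithinAt ?_
  rcases eq_or_ne z (-1) with rfl | h
  · exact continuousAt_regularPart_neg_one p
  have hd := (hasDerivAt_logOneAdd (one_add_mem_slitPlane hz h)).differentiableAt
  have hs (a : ℂ) : ContinuousAt (dslope logOneAdd a) z := by
    rcases eq_or_ne z a with rfl | ha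
    · exact continuousAt_dslope_same.2 hd
    · exact (continuousAt_dslope_of_ne ha).2 hd.continuousAt
  exact (hs 0).div ((continuousAt_const.sub hd.continuousAt).mul (hs _))
    (mul_ne_zero (sub_logOneAdd_ne_zero hp hz) (dslope_logOneAdd_ne_zero p h))

lemma differentiableAt_regularPart {p : ℝ} (hp : Real.log 2 < p) {z : ℂ} (hz : ‖z‖ < 1)
    (h0 : z ≠ 0) (hw : z ≠ (Real.exp (-p) - 1 : ℝ)) : DifferentiableAt ℂ (regularPart p) z := by
  have h : z ≠ -1 := by rintro rfl; simp at hz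
  have hd := (hasDerivAt_logOneAdd (one_add_mem_slitPlane hz.le h)).differentiableAt
  exact ((differentiableAt_dslope_of_ne h0).2 hd).div
    (((differentiableAt_const _).sub hd).mul ((differentiableAt_dslope_of_ne hw).2 hd))
    (mul_ne_zero (sub_logOneAdd_ne_zero hp hz.le) (dslope_logOneAdd_ne_zero p h))

lemma regularPart_zero {p : ℝ} (hp : 0 < p) :
    regularPart p 0 = -(Real.exp (-p) - 1 : ℝ) / (p : ℂ) ^ 2 := by
  have h := exp_neg_sub_one_ne_zero hp
  rw [regularPart, dslope_same, dslope_of_ne _ h.symm, slope_def_field, logOneAdd_zero,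
    logOneAdd_exp_neg_sub_one, (hasDerivAt_logOneAdd (by simp)).deriv]
  have hp' : (p : ℂ) ≠ 0 := by exact_mod_cast hp.ne'
  generalize ((Real.exp (-p) - 1 : ℝ) : ℂ) = w at h
  simp only [add_zero, div_one, sub_zero, zero_sub, sub_neg_eq_add, zero_add]
  field_simp

lemma regularPart_exp_neg_sub_one {p : ℝ} (hp : 0 < p) :
    regularPart p (Real.exp (-p) - 1 : ℝ) =
      -(Real.exp (-p) : ℝ) / (2 * (Real.exp (-p) - 1 : ℝ)) := by
  have h := exp_neg_sub_one_ne_zero hp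
  rw [regularPart, dslope_same, dslope_of_ne _ h, slope_def_field, logOneAdd_zero,
    logOneAdd_exp_neg_sub_one, deriv_logOneAdd_exp_neg_sub_one p]
  have hp' : (p : ℂ) ≠ 0 := by exact_mod_cast hp.ne'
  have hq : ((Real.exp (-p) : ℝ) : ℂ) ≠ 0 := by exact_mod_cast Real.exp_ne_zero _
  field_simp
  ring

lemma polePair_logOneAdd_eq {p : ℝ} (hp : 0 < p) {z : ℂ} (hz : z ∈ Metric.sphere (0 : ℂ) 1) :
    polePair p (logOneAdd z) =
      (z - (Real.exp (-p) - 1 : ℝ))⁻¹ * (z * regularPart p z) := by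
  have h0 : z ≠ 0 := by rintro rfl; simp at hz
  have hw : z ≠ (Real.exp (-p) - 1 : ℝ) := by
    rintro rfl
    exact (Metric.sphere_disjoint_ball.le_bot ⟨hz, exp_neg_sub_one_mem_ball hp⟩).elim
  rw [regularPart_eq p h0 hw]
  have := sub_ne_zero.2 hw
  field_simp

lemma continuousOn_polePair_logOneAdd {p : ℝ} (hp : Real.log 2 < p) :
    ContinuousOn (fun z => polePair p (logOneAdd z)) (Metric.sphere 0 1) := by
  have hp0 : 0 < p := (Real.log_pos one_lt_two).trans hp
  refine ContinuousOn.congr ?_ fun z hz => polePair_logOneAdd_eq hp0 hz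
  refine ContinuousOn.mul ((continuousOn_id.sub continuousOn_const).inv₀ fun z hz h => ?_)
    (continuousOn_id.mul ((continuousOn_regularPart hp).mono Metric.sphere_subset_closedBall))
  obtain rfl : z = (Real.exp (-p) - 1 : ℝ) := sub_eq_zero.1 h
  exact (Metric.sphere_disjoint_ball.le_bot ⟨hz, exp_neg_sub_one_mem_ball hp0⟩).elim

lemma circleIntegral_polePair {p : ℝ} (hp : Real.log 2 < p) :
    ∮ z in C(0, 1), (1 + 1 / z ^ 2) * polePair p (logOneAdd z) =
      (2 * π * Complex.I) * ((1 / p ^ 2 - Real.exp (-p) / 2 -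
        Real.exp (-p) / (1 - Real.exp (-p)) ^ 2 / 2 : ℝ) : ℂ) := by
  have hp0 : 0 < p := (Real.log_pos one_lt_two).trans hp
  set w : ℂ := ((Real.exp (-p) - 1 : ℝ) : ℂ) with hw
  have hw0 : w ≠ 0 := exp_neg_sub_one_ne_zero hp0
  have hwb : w ∈ Metric.ball (0 : ℂ) 1 := exp_neg_sub_one_mem_ball hp0
  have h0b : (0 : ℂ) ∈ Metric.ball (0 : ℂ) 1 := by simp
  have hc := continuousOn_regularPart hp
  have hd : ∀ z ∈ Metric.ball (0 : ℂ) 1 \ {0, w}, DifferentiableAt ℂ (regularPart p) z := by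
    rintro z ⟨hz, hz'⟩
    simp only [Set.mem_insert_iff, Set.mem_singleton_iff, not_or] at hz'
    exact differentiableAt_regularPart hp (mem_ball_zero_iff.1 hz) hz'.1 hz'.2
  have hcount : ({0, w} : Set ℂ).Countable := (Set.toFinite _).countable
  have A := Complex.circleIntegral_sub_inv_smul_of_differentiable_on_off_countable hcount hwb
    (f := fun z => (z + w⁻¹) * regularPart p z) ((by fun_prop : ContinuousOn _ _).mul hc)
    (fun z hz => (by fun_prop : DifferentiableAt ℂ _ _).mul (hd z hz))
  have B := Complex.circleIntegral_sub_inv_smul_of_differentiable_on_off_countable hcount h0b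
    (f := fun z => w⁻¹ * regularPart p z) (continuousOn_const.mul hc)
    (fun z hz => (differentiableAt_const _).mul (hd z hz))
  have hcs := hc.mono Metric.sphere_subset_closedBall
  have hne {a z : ℂ} (ha : a ∈ Metric.ball (0 : ℂ) 1) (hz : z ∈ Metric.sphere (0 : ℂ) 1) :
      z - a ≠ 0 := by
    intro h
    rw [sub_eq_zero.1 h] at hz
    exact (Metric.sphere_disjoint_ball.le_bot ⟨hz, ha⟩).elim
  have hiA : CircleIntegrable (fun z => (z - w)⁻¹ • ((z + w⁻¹) * regularPart p z)) 0 1 :=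
    ContinuousOn.circleIntegrable zero_le_one
      (((by fun_prop : ContinuousOn _ _).inv₀ fun z hz => hne hwb hz).smul
        ((by fun_prop : ContinuousOn _ _).mul hcs))
  have hiB : CircleIntegrable (fun z => (z - 0)⁻¹ • (w⁻¹ * regularPart p z)) 0 1 :=
    ContinuousOn.circleIntegrable zero_le_one
      (((by fun_prop : ContinuousOn _ _).inv₀ fun z hz => hne h0b hz).smul
        (continuousOn_const.mul hcs))
  have C : ∮ z in C(0, 1), (1 + 1 / z ^ 2) * polePair p (logOneAdd z) =
      ∮ z in C(0, 1), ((z - w)⁻¹ • ((z + w⁻¹) * regularPart p z) -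
        (z - 0)⁻¹ • (w⁻¹ * regularPart p z)) := by
    refine circleIntegral.integral_congr zero_le_one fun z hz => ?_
    have h1 := hne hwb hz
    have h2 : z ≠ 0 := by simpa using hne h0b hz
    simp only [polePair_logOneAdd_eq hp0 hz, ← hw, smul_eq_mul, sub_zero]
    field_simp
    ring
  rw [C, circleIntegral.integral_sub hiA hiB, A, B]
  simp only [smul_eq_mul]
  rw [regularPart_zero hp0, hw, regularPart_exp_neg_sub_one hp0, ← hw]
  have hp' : (p : ℂ) ≠ 0 := by exact_mod_cast hp0.ne'
  have hq : ((Real.exp (-p) : ℝ) : ℂ) = 1 + w := by rw [hw]; push_cast; ring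
  push_cast [-Complex.ofReal_exp]
  rw [hq]
  rw [show (1 : ℂ) - (1 + w) = -w by ring]
  field_simp
  ring

lemma conj_polePair (p : ℝ) (u : ℂ) :
    polePair p ((starRingEnd ℂ) u) = (starRingEnd ℂ) (polePair p u) := by
  simp [polePair]

lemma logOneAdd_conj {z : ℂ} (hz : ‖z‖ ≤ 1) :
    logOneAdd ((starRingEnd ℂ) z) = (starRingEnd ℂ) (logOneAdd z) := by
  rcases eq_or_ne z (-1) with rfl | h
  · simp [logOneAdd]
  · rw [logOneAdd, logOneAdd,
      ← Complex.log_conj _ (Complex.slitPlane_arg_ne_pi (one_add_mem_slitPlane hz h))]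
    simp

/-- The logarithm of `1 + exp (2 * I * x)` for `|x| < π / 2`. -/
noncomputable def logCurve (x : ℝ) : ℂ := Real.log (2 * Real.cos x) + x * Complex.I

lemma logOneAdd_circleMap {x : ℝ} (hx : x ∈ Set.Ioo (-(π / 2)) (π / 2)) :
    logOneAdd (circleMap 0 1 (2 * x)) = logCurve x := by
  have hc := Real.cos_pos_of_mem_Ioo hx
  have h : 1 + circleMap 0 1 (2 * x) =
      ((2 * Real.cos x : ℝ) : ℂ) * Complex.exp (x * Complex.I) := by
    have h1 : Complex.exp (-x * Complex.I) * Complex.exp (x * Complex.I) = 1 := by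
      rw [← Complex.exp_add]; simp
    have h2 : Complex.exp (x * Complex.I) * Complex.exp (x * Complex.I) =
        Complex.exp (2 * x * Complex.I) := by
      rw [← Complex.exp_add]; ring_nf
    simp only [circleMap]
    push_cast
    rw [Complex.two_cos, add_mul, h1, h2]
    ring
  rw [logOneAdd, h, Complex.log_ofReal_mul (by positivity) (Complex.exp_ne_zero _),
    Complex.log_exp, logCurve]
  · simp; linarith [hx.1, Real.pi_pos]
  · simp; linarith [hx.2, Real.pi_pos]

lemma continuous_polePair_circleMap {p : ℝ} (hp : Real.log 2 < p) :
    Continuous fun θ => polePair p (logOneAdd (circleMap 0 1 θ)) :=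
  (continuousOn_polePair_logOneAdd hp).comp_continuous (continuous_circleMap 0 1)
    (circleMap_mem_sphere 0 zero_le_one)

lemma integral_cos_mul_polePair_circleMap {p : ℝ} (hp : Real.log 2 < p) :
    ∫ θ in (0 : ℝ)..2 * π, Real.cos θ * (polePair p (logOneAdd (circleMap 0 1 θ))).re =
      π * (1 / p ^ 2 - Real.exp (-p) / 2 - Real.exp (-p) / (1 - Real.exp (-p)) ^ 2 / 2) := by
  set V := 1 / p ^ 2 - Real.exp (-p) / 2 - Real.exp (-p) / (1 - Real.exp (-p)) ^ 2 / 2 with hV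
  have hG := continuous_polePair_circleMap hp
  have h := circleIntegral_polePair hp
  rw [circleIntegral, ← hV] at h
  have h1 : ∀ θ : ℝ, deriv (circleMap 0 1) θ •
      ((1 + 1 / circleMap 0 1 θ ^ 2) * polePair p (logOneAdd (circleMap 0 1 θ))) =
      (2 * Complex.I) * (Real.cos θ * polePair p (logOneAdd (circleMap 0 1 θ))) := by
    intro θ
    have hz : circleMap 0 1 θ ≠ 0 := circleMap_ne_center one_ne_zero
    have hc : 2 * (Real.cos θ : ℂ) = circleMap 0 1 θ + (circleMap 0 1 θ)⁻¹ := by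
      rw [Complex.ofReal_cos, Complex.two_cos]
      simp [circleMap, ← Complex.exp_neg]
    rw [deriv_circleMap, smul_eq_mul,
      show (2 * Complex.I) * (Real.cos θ * polePair p (logOneAdd (circleMap 0 1 θ))) =
        Complex.I * (2 * (Real.cos θ : ℂ)) * polePair p (logOneAdd (circleMap 0 1 θ)) by ring, hc]
    field_simp
  simp only [h1] at h
  rw [intervalIntegral.integral_const_mul] at h
  have h2 : ∫ θ in (0 : ℝ)..2 * π,
      (Real.cos θ : ℂ) * polePair p (logOneAdd (circleMap 0 1 θ)) = (π * V : ℝ) := by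
    have hI : (2 * Complex.I) ≠ 0 := by simp
    refine mul_left_cancel₀ hI (h.trans ?_)
    push_cast; ring
  have h3 := Complex.reCLM.intervalIntegral_comp_comm (μ := MeasureTheory.volume)
    (f := fun θ : ℝ => (Real.cos θ : ℂ) * polePair p (logOneAdd (circleMap 0 1 θ)))
    (((by fun_prop : Continuous fun θ : ℝ => (Real.cos θ : ℂ)).mul hG).intervalIntegrable 0 (2 * π))
  rw [h2] at h3
  simpa only [Complex.reCLM_apply, Complex.re_ofReal_mul, Complex.ofReal_re] using h3

lemma integral_cos_two_mul_polePair {p : ℝ} (hp : Real.log 2 < p) :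
    ∫ x in (0 : ℝ)..π / 2, Real.cos (2 * x) * (polePair p (logCurve x)).re =
      π / 4 *
        (1 / p ^ 2 - Real.exp (-p) / 2 - Real.exp (-p) / (1 - Real.exp (-p)) ^ 2 / 2) := by
  set R : ℝ → ℝ := fun θ => Real.cos θ * (polePair p (logOneAdd (circleMap 0 1 θ))).re with hR
  have hcont : Continuous R :=
    Real.continuous_cos.mul (Complex.continuous_re.comp (continuous_polePair_circleMap hp))
  have hper : Function.Periodic R (2 * π) := fun θ => by
    simp [hR, periodic_circleMap 0 1 θ, Real.cos_periodic θ]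
  have heven : ∀ θ, R (-θ) = R θ := fun θ => by
    have : circleMap 0 1 (-θ) = (starRingEnd ℂ) (circleMap 0 1 θ) := by
      simp [circleMap, ← Complex.exp_conj]
    simp only [hR]
    rw [Real.cos_neg, this, logOneAdd_conj (by simp), conj_polePair, Complex.conj_re]
  have h1 : ∫ θ in (0 : ℝ)..2 * π, R θ = ∫ θ in -π..π, R θ := by
    have := hper.intervalIntegral_add_eq 0 (-π)
    rwa [zero_add, show -π + 2 * π = π by ring] at this
  have h2 : ∫ θ in -π..π, R θ = 2 * ∫ θ in (0 : ℝ)..π, R θ := by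
    rw [← intervalIntegral.integral_add_adjacent_intervals (hcont.intervalIntegrable _ 0)
      (hcont.intervalIntegrable _ _)]
    have := intervalIntegral.integral_comp_neg (a := 0) (b := π) R
    rw [neg_zero] at this
    rw [← this]
    simp only [heven]
    ring
  have h3 : ∫ x in (0 : ℝ)..π / 2, R (2 * x) = 2⁻¹ * ∫ θ in (0 : ℝ)..π, R θ := by
    rw [intervalIntegral.integral_comp_mul_left R two_ne_zero, smul_eq_mul, mul_zero,
      mul_div_cancel₀ _ two_ne_zero]
  have h4 : ∫ x in (0 : ℝ)..π / 2, Real.cos (2 * x) * (polePair p (logCurve x)).re =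
      ∫ x in (0 : ℝ)..π / 2, R (2 * x) := by
    refine intervalIntegral.integral_congr_ae ?_
    filter_upwards [MeasureTheory.Measure.ae_ne MeasureTheory.volume (π / 2)] with x hx hx'
    rw [Set.uIoc_of_le (by positivity)] at hx'
    simp only [hR]
    rw [logOneAdd_circleMap ⟨by linarith [hx'.1, Real.pi_pos], lt_of_le_of_ne hx'.2 hx⟩]
  have h5 := integral_cos_mul_polePair_circleMap hp
  linarith

lemma mem_integerComplement_of_im_pos {x : ℂ} (hx : 0 < x.im) : x ∈ Complex.integerComplement := by
  rintro ⟨n, rfl⟩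
  simp at hx

lemma Complex.tan_eq_cot_sub_two_mul_cot {w : ℂ} (hs : Complex.sin w ≠ 0)
    (hc : Complex.cos w ≠ 0) :
    Complex.tan w = Complex.cot w - 2 * Complex.cot (2 * w) := by
  rw [Complex.tan, Complex.cot, Complex.cot, Complex.sin_two_mul, Complex.cos_two_mul']
  field_simp
  ring

lemma Complex.sin_ne_zero_of_im_pos {w : ℂ} (hw : 0 < w.im) : Complex.sin w ≠ 0 := by
  rw [Ne, Complex.sin_eq_zero_iff]
  rintro ⟨k, rfl⟩
  simp at hw

lemma Complex.cos_ne_zero_of_im_pos {w : ℂ} (hw : 0 < w.im) : Complex.cos w ≠ 0 := by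
  rw [← Complex.sin_add_pi_div_two]
  exact Complex.sin_ne_zero_of_im_pos (by
    rw [Complex.add_im, show ((π : ℂ) / 2).im = 0 by
      rw [show (π : ℂ) / 2 = ((π / 2 : ℝ) : ℂ) by push_cast; rfl, Complex.ofReal_im]]
    simpa using hw)

lemma hasSum_cotTerm {x : ℂ} (hx : 0 < x.im) :
    HasSum (cotTerm x) (π * Complex.cot (π * x) - 1 / x) := by
  have h := mem_integerComplement_of_im_pos hx
  rw [cot_series_rep' h]
  exact (summable_cotTerm h).hasSum

lemma hasSum_polePair_tan {α : ℝ} (hα : 0 < α) {u : ℂ} (hu : 0 < u.im) :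
    HasSum (fun k : ℕ => 4 * α * polePair (π * α * (2 * k + 1)) u)
      (Complex.tan (u / (2 * α))) := by
  have hπ : (π : ℂ) ≠ 0 := by exact_mod_cast Real.pi_ne_zero
  have hα' : (α : ℂ) ≠ 0 := by exact_mod_cast hα.ne'
  have hu0 : u ≠ 0 := by rintro rfl; simp at hu
  set x : ℂ := u / (2 * α * π) with hx
  have hxu : u = 2 * α * π * x := by rw [hx]; field_simp
  have him : x.im = u.im / (2 * α * π) := by
    rw [hx, show (2 * α * π : ℂ) = ((2 * α * π : ℝ) : ℂ) by push_cast; ring, Complex.div_ofReal_im]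
  have hxim : 0 < x.im := by rw [him]; positivity
  have h2im : 0 < (2 * x).im := by simpa using hxim
  have hx0 : x ≠ 0 := by rintro h; simp [h] at hxim
  have hw : u / (2 * α) = π * x := by rw [hxu]; field_simp
  have hwim : 0 < (π * x : ℂ).im := by
    rw [Complex.im_ofReal_mul]; positivity
  have hs1 := hasSum_cotTerm hxim
  have hs2 := hasSum_cotTerm h2im
  have hodd : HasSum (fun k : ℕ => cotTerm (2 * x) (2 * k + 1))
      ((π * Complex.cot (π * x) - 1 / x) / 2) := by
    have h (k : ℕ) : cotTerm (2 * x) (2 * k + 1) = cotTerm x k / 2 := by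
      simp only [cotTerm, add_div, div_div]
      push_cast
      ring_nf
    simpa only [h] using hs1.div_const 2
  have hev : Summable fun k : ℕ => cotTerm (2 * x) (2 * k) :=
    (summable_cotTerm (mem_integerComplement_of_im_pos h2im)).comp_injective
      (mul_right_injective₀ two_ne_zero)
  have hE := hs2.unique (hev.hasSum.even_add_odd hodd)
  have hval : (-2 / π) * ∑' k : ℕ, cotTerm (2 * x) (2 * k) = Complex.tan (u / (2 * α)) := by
    rw [hw, Complex.tan_eq_cot_sub_two_mul_cot (Complex.sin_ne_zero_of_im_pos hwim)
      (Complex.cos_ne_zero_of_im_pos hwim)]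
    rw [show (π : ℂ) * (2 * x) = 2 * (π * x) by ring] at hE
    rw [← sub_eq_iff_eq_add.2 hE]
    field_simp
    ring
  rw [← hval]
  have hm := mem_integerComplement_of_im_pos h2im
  have hk (k : ℕ) : 4 * α * polePair (π * α * (2 * k + 1)) u =
      -2 / π * cotTerm (2 * x) (2 * k) := by
    have hadd : 2 * x + (2 * k + 1) ≠ 0 := by
      simpa using Complex.integerComplement_add_ne_zero hm (2 * k + 1)
    have hsub : 2 * x - (2 * k + 1) ≠ 0 := by
      have := Complex.integerComplement_add_ne_zero hm (-(2 * k + 1))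
      push_cast at this
      rwa [← sub_eq_add_neg] at this
    rw [cotTerm_identity hm, polePair, hxu]
    push_cast
    rw [show ((π : ℂ) * α * (2 * k + 1)) ^ 2 - (2 * α * π * x) ^ 2 =
      -(π * α) ^ 2 * ((2 * x + (2 * k + 1)) * (2 * x - (2 * k + 1))) by ring]
    field_simp
    ring
  simpa only [hk] using hev.hasSum.mul_left (-2 / π : ℂ)

lemma hasSum_one_div_odd_sq : HasSum (fun k : ℕ => 1 / (2 * (k : ℝ) + 1) ^ 2) (π ^ 2 / 8) := by
  have hz := hasSum_zeta_two
  set f : ℕ → ℝ := fun n => 1 / (n : ℝ) ^ 2 with hf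
  have hev : HasSum (fun k : ℕ => f (2 * k)) (π ^ 2 / 6 / 4) := by
    have h (k : ℕ) : f (2 * k) = f k / 4 := by
      simp only [hf]
      push_cast
      rw [mul_pow, div_div, mul_comm]
      norm_num
    simpa only [h] using hz.div_const 4
  have hinj : Function.Injective fun k : ℕ => 2 * k + 1 := fun a b h => by
    simpa using h
  have hodd : Summable fun k : ℕ => f (2 * k + 1) := hz.summable.comp_injective hinj
  have h := hz.unique (hev.even_add_odd hodd.hasSum)
  have h2 := hodd.hasSum
  rw [show ∑' k : ℕ, f (2 * k + 1) = π ^ 2 / 8 by linarith] at h2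
  simpa [hf] using h2

lemma re_tan_logCurve_eq {α : ℝ} (hα : 0 < α) (x : ℝ) :
    (Complex.tan (logCurve x / (2 * α))).re =
      Real.sin (Real.log (2 * Real.cos x) / α) /
        (Real.cosh (x / α) + Real.cos (Real.log (2 * Real.cos x) / α)) := by
  set a : ℝ := Real.log (2 * Real.cos x) / (2 * α) with ha
  set b : ℝ := x / (2 * α) with hb
  have hw : logCurve x / (2 * α) = a + b * Complex.I := by
    rw [logCurve, ha, hb]; push_cast; ring
  have h1 : Real.log (2 * Real.cos x) / α = 2 * a := by rw [ha]; field_simp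
  have h2 : x / α = 2 * b := by rw [hb]; field_simp
  rw [hw, h1, h2, Complex.tan, Complex.sin_add_mul_I, Complex.cos_add_mul_I]
  simp only [← Complex.ofReal_sin, ← Complex.ofReal_cos, ← Complex.ofReal_sinh,
    ← Complex.ofReal_cosh]
  rw [Complex.div_re]
  simp only [Complex.normSq_apply, Complex.add_re, Complex.sub_re, Complex.add_im, Complex.sub_im,
    Complex.mul_re, Complex.mul_im, Complex.ofReal_re, Complex.ofReal_im, Complex.I_re,
    Complex.I_im, mul_zero, mul_one, zero_mul, sub_zero, add_zero, zero_add, zero_sub]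
  have hcs := Real.cosh_sq b
  have hsc := Real.sin_sq_add_cos_sq a
  rw [← add_div, Real.sin_two_mul, Real.cos_two_mul, Real.cosh_two_mul]
  have hden : Real.cosh b ^ 2 + Real.sinh b ^ 2 + (2 * Real.cos a ^ 2 - 1) =
    2 * (Real.cos a * Real.cosh b * (Real.cos a * Real.cosh b) +
      -(Real.sin a * Real.sinh b) * -(Real.sin a * Real.sinh b)) := by
    have e1 : Real.cosh b ^ 2 = 1 + Real.sinh b ^ 2 := by linarith
    have e2 : Real.sin a ^ 2 = 1 - Real.cos a ^ 2 := by linarith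
    linear_combination (1 - 2 * Real.cos a ^ 2) * e1 - 2 * Real.sinh b ^ 2 * e2
  rw [hden, show 2 * Real.sin a * Real.cos a = 2 * (Real.sin a * Real.cos a) by ring,
    mul_div_mul_left _ _ two_ne_zero]
  congr 1
  linear_combination Real.sin a * Real.cos a * hcs

lemma logCurve_re (x : ℝ) : (logCurve x).re = Real.log (2 * Real.cos x) := by
  rw [logCurve, Complex.add_re, Complex.ofReal_re, Complex.re_ofReal_mul, Complex.I_re,
    mul_zero, add_zero]

lemma logCurve_im (x : ℝ) : (logCurve x).im = x := by
  rw [logCurve, Complex.add_im, Complex.ofReal_im, Complex.im_ofReal_mul, Complex.I_im,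
    mul_one, zero_add]

lemma log_two_mul_cos_le {x : ℝ} (hx : x ∈ Set.Ioo 0 (π / 2)) :
    Real.log (2 * Real.cos x) ≤ Real.log 2 := by
  have := Real.cos_pos_of_mem_Ioo ⟨by linarith [hx.1, Real.pi_pos], hx.2⟩
  exact Real.log_le_log (by positivity) (by linarith [Real.cos_le_one x])

lemma le_norm_sq_sub_logCurve_sq {p₀ p x : ℝ} (h₀ : Real.log 2 < p₀) (hp : p₀ ≤ p)
    (hx : x ∈ Set.Ioo 0 (π / 2)) :
    (p₀ - Real.log 2) * min p₀ (π / 3) ≤ ‖(p : ℂ) ^ 2 - logCurve x ^ 2‖ := by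
  have hp0 : 0 < p₀ := (Real.log_pos one_lt_two).trans h₀
  have hsub : p₀ - Real.log 2 ≤ ‖(p : ℂ) - logCurve x‖ := by
    have h1 := Complex.re_le_norm ((p : ℂ) - logCurve x)
    rw [Complex.sub_re, Complex.ofReal_re, logCurve_re] at h1
    linarith [log_two_mul_cos_le hx]
  have hadd : min p₀ (π / 3) ≤ ‖(p : ℂ) + logCurve x‖ := by
    rcases le_total x (π / 3) with h | h
    · have h1 := Complex.re_le_norm ((p : ℂ) + logCurve x)
      rw [Complex.add_re, Complex.ofReal_re, logCurve_re] at h1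
      have h2 := Real.cos_le_cos_of_nonneg_of_le_pi hx.1.le (by linarith [Real.pi_pos]) h
      rw [Real.cos_pi_div_three] at h2
      have h3 : 0 ≤ Real.log (2 * Real.cos x) := Real.log_nonneg (by linarith)
      exact (min_le_left _ _).trans (by linarith)
    · have h1 := Complex.abs_im_le_norm ((p : ℂ) + logCurve x)
      rw [Complex.add_im, Complex.ofReal_im, logCurve_im, zero_add] at h1
      exact (min_le_right _ _).trans (h.trans ((le_abs_self x).trans h1))
  rw [show (p : ℂ) ^ 2 - logCurve x ^ 2 = (p - logCurve x) * (p + logCurve x) by ring, norm_mul]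
  have : 0 ≤ min p₀ (π / 3) := by positivity
  gcongr

lemma one_add_norm_logCurve_pow_le {x : ℝ} (hx : x ∈ Set.Ioo 0 (π / 2)) :
    (1 + ‖logCurve x‖) ^ 3 ≤ 729 * (2 + (π / 2 - x) ^ (-(1 / 2) : ℝ)) := by
  have hcos := Real.cos_pos_of_mem_Ioo ⟨by linarith [hx.1, Real.pi_pos], hx.2⟩
  set L := Real.log (2 * Real.cos x) with hL
  have hs : 0 < π / 2 - x := by linarith [hx.2]
  have h1 : ‖logCurve x‖ ≤ |L| + 2 := by
    have := Complex.norm_le_abs_re_add_abs_im (logCurve x)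
    rw [logCurve_re, logCurve_im, abs_of_pos hx.1] at this
    linarith [hx.2, Real.pi_le_four]
  have h2 : 1 + ‖logCurve x‖ ≤ 9 * Real.exp (|L| / 6) := by
    linarith [Real.add_one_le_exp (|L| / 6), abs_nonneg L]
  have h3 : Real.exp (|L| / 2) ≤ 2 + (π / 2 - x) ^ (-(1 / 2) : ℝ) := by
    have hr : 0 < (π / 2 - x) ^ (-(1 / 2) : ℝ) := Real.rpow_pos_of_pos hs _
    rcases le_total 0 L with h | h
    · rw [abs_of_nonneg h]
      have : Real.exp (L / 2) ≤ Real.exp (Real.log 2) :=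
        Real.exp_le_exp.2 (by linarith [log_two_mul_cos_le hx])
      rw [Real.exp_log two_pos] at this
      linarith
    · rw [abs_of_nonpos h]
      have e : Real.exp (-L / 2) = (2 * Real.cos x) ^ (-(1 / 2) : ℝ) := by
        rw [Real.rpow_def_of_pos (by positivity)]
        congr 1; ring
      have hle : π / 2 - x ≤ 2 * Real.cos x := by
        have hj := Real.one_sub_mul_le_cos hx.1.le hx.2.le
        have : π / 2 - x ≤ 4 / π * (π / 2 - x) :=
          le_mul_of_one_le_left hs.le ((one_le_div Real.pi_pos).2 Real.pi_le_four)
        have e2 : 4 / π * (π / 2 - x) = 2 * (1 - 2 / π * x) := by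
          have := Real.pi_ne_zero
          field_simp
          norm_num
        linarith
      rw [e]
      linarith [Real.rpow_le_rpow_of_nonpos hs hle (by norm_num : (-(1 / 2) : ℝ) ≤ 0)]
  calc (1 + ‖logCurve x‖) ^ 3 ≤ (9 * Real.exp (|L| / 6)) ^ 3 := by gcongr
    _ = 729 * Real.exp (|L| / 2) := by
      rw [mul_pow, ← Real.exp_nat_mul]
      norm_num
      ring_nf
    _ ≤ _ := by gcongr

lemma exists_norm_polePair_logCurve_le {p₀ : ℝ} (h₀ : Real.log 2 < p₀) :
    ∃ C : ℝ, ∀ p ≥ p₀, ∀ x ∈ Set.Ioo 0 (π / 2),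
      ‖polePair p (logCurve x)‖ ≤ C * (2 + (π / 2 - x) ^ (-(1 / 2) : ℝ)) * (1 / p ^ 2) := by
  have hp0 : 0 < p₀ := (Real.log_pos one_lt_two).trans h₀
  set δ := (p₀ - Real.log 2) * min p₀ (π / 3) with hδ
  have hδ0 : 0 < δ := mul_pos (by linarith) (by positivity)
  refine ⟨(1 + 1 / δ) * 729, fun p hp x hx => ?_⟩
  have hD := le_norm_sq_sub_logCurve_sq h₀ hp hx
  rw [← hδ] at hD
  set D := ‖(p : ℂ) ^ 2 - logCurve x ^ 2‖
  set r := ‖logCurve x‖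
  have hr0 : 0 ≤ r := norm_nonneg _
  have hpp : 0 < p := hp0.trans_le hp
  have hD0 : 0 < D := hδ0.trans_le hD
  have h1 : p ^ 2 ≤ D + r ^ 2 := by
    have := norm_add_le ((p : ℂ) ^ 2 - logCurve x ^ 2) (logCurve x ^ 2)
    rwa [sub_add_cancel, norm_pow, norm_pow, Complex.norm_real, Real.norm_eq_abs, sq_abs] at this
  have h2 : r ^ 2 ≤ r ^ 2 / δ * D := by
    rw [div_mul_eq_mul_div, le_div_iff₀ hδ0]
    gcongr
  have h3 : r * (1 + r ^ 2 / δ) ≤ (1 + 1 / δ) * (1 + r) ^ 3 := by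
    have e : (1 + 1 / δ) * (1 + r) ^ 3 - r * (1 + r ^ 2 / δ) =
      (1 + 2 * r + 3 * r ^ 2 + r ^ 3) + 1 / δ * (1 + 3 * r + 3 * r ^ 2) := by ring
    have : 0 ≤ (1 + 2 * r + 3 * r ^ 2 + r ^ 3) + 1 / δ * (1 + 3 * r + 3 * r ^ 2) := by positivity
    linarith
  have h4 := mul_le_mul_of_nonneg_left (one_add_norm_logCurve_pow_le hx)
    (by positivity : 0 ≤ 1 + 1 / δ)
  rw [polePair, norm_div, mul_one_div, div_le_div_iff₀ hD0 (by positivity)]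
  calc r * p ^ 2 ≤ r * (D + r ^ 2 / δ * D) := by gcongr; linarith
    _ = r * (1 + r ^ 2 / δ) * D := by ring
    _ ≤ (1 + 1 / δ) * 729 * (2 + (π / 2 - x) ^ (-(1 / 2) : ℝ)) * D :=
      mul_le_mul_of_nonneg_right (by linarith) hD0.le

lemma intervalIntegrable_rpow_pi_div_two_sub (C : ℝ) :
    IntervalIntegrable (fun x : ℝ => C * (2 + (π / 2 - x) ^ (-(1 / 2) : ℝ)))
      MeasureTheory.volume 0 (π / 2) := by
  have h := (intervalIntegral.intervalIntegrable_rpow' (a := π / 2) (b := 0)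
    (by norm_num : (-1 : ℝ) < -(1 / 2))).comp_sub_left (π / 2)
  simp only [sub_self, sub_zero] at h
  exact (intervalIntegrable_const.add h).const_mul C

lemma hasSum_integral_polePair {α : ℝ} (hα : 0 < α) (h₀ : Real.log 2 < π * α) :
    HasSum (fun k : ℕ => ∫ x in (0 : ℝ)..π / 2,
        4 * α * (Real.cos (2 * x) * (polePair (π * α * (2 * k + 1)) (logCurve x)).re))
      (∫ x in (0 : ℝ)..π / 2, Real.cos (2 * x) * (Complex.tan (logCurve x / (2 * α))).re) := by
  obtain ⟨C, hC⟩ := exists_norm_polePair_logCurve_le h₀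
  have hmeas : Measurable logCurve := by unfold logCurve; fun_prop
  have hmem : ∀ᵐ x : ℝ, x ∈ Set.uIoc 0 (π / 2) → x ∈ Set.Ioo 0 (π / 2) := by
    filter_upwards [MeasureTheory.Measure.ae_ne MeasureTheory.volume (π / 2)] with x hx hx'
    rw [Set.uIoc_of_le (by positivity)] at hx'
    exact ⟨hx'.1, lt_of_le_of_ne hx'.2 hx⟩
  have hsum : Summable fun k : ℕ => 1 / (π * α * (2 * (k : ℝ) + 1)) ^ 2 := by
    have h (k : ℕ) : 1 / (π * α * (2 * (k : ℝ) + 1)) ^ 2 =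
        1 / (2 * (k : ℝ) + 1) ^ 2 / (π * α) ^ 2 := by
      rw [mul_pow, div_div, mul_comm]
    simpa only [h] using hasSum_one_div_odd_sq.summable.div_const ((π * α) ^ 2)
  refine intervalIntegral.hasSum_integral_of_dominated_convergence
    (fun k x => 4 * α * C * (2 + (π / 2 - x) ^ (-(1 / 2) : ℝ)) *
      (1 / (π * α * (2 * (k : ℝ) + 1)) ^ 2)) (fun k => ?_) (fun k => ?_) ?_ ?_ ?_
  · have : Measurable fun x => polePair (π * α * (2 * (k : ℝ) + 1)) (logCurve x) := by
      unfold polePair; fun_prop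
    exact Measurable.aestronglyMeasurable (by fun_prop)
  · filter_upwards [hmem] with x hx hx'
    have h1 := hC (π * α * (2 * (k : ℝ) + 1))
      (le_mul_of_one_le_right (by positivity) (by linarith [k.cast_nonneg (α := ℝ)])) x (hx hx')
    rw [norm_mul (4 * α), Real.norm_of_nonneg (by positivity : 0 ≤ 4 * α), norm_mul]
    have h2 : ‖Real.cos (2 * x)‖ *
        ‖(polePair (π * α * (2 * (k : ℝ) + 1)) (logCurve x)).re‖ ≤
        1 * ‖polePair (π * α * (2 * (k : ℝ) + 1)) (logCurve x)‖ :=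
      mul_le_mul (Real.abs_cos_le_one _) (Complex.abs_re_le_norm _) (norm_nonneg _) zero_le_one
    rw [one_mul] at h2
    calc _ ≤ 4 * α * (C * (2 + (π / 2 - x) ^ (-(1 / 2) : ℝ)) *
          (1 / (π * α * (2 * (k : ℝ) + 1)) ^ 2)) :=
          mul_le_mul_of_nonneg_left (h2.trans h1) (by positivity)
      _ = _ := by ring
  · exact Filter.Eventually.of_forall fun x _ => hsum.mul_left _
  · simp only [tsum_mul_left]
    exact (intervalIntegrable_rpow_pi_div_two_sub _).mul_const _
  · filter_upwards [hmem] with x hx hx'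
    have h1 := hasSum_polePair_tan hα (u := logCurve x) (by rw [logCurve_im]; exact (hx hx').1)
    have h2 := (Complex.hasSum_re h1).mul_left (Real.cos (2 * x))
    have h3 (k : ℕ) : 4 * α * (Real.cos (2 * x) *
          (polePair (π * α * (2 * k + 1)) (logCurve x)).re) =
        Real.cos (2 * x) * (4 * α * polePair (π * α * (2 * k + 1)) (logCurve x)).re := by
      rw [show (4 * α : ℂ) = ((4 * α : ℝ) : ℂ) by push_cast; rfl, Complex.re_ofReal_mul]
      ring
    simpa only [h3] using h2

lemma exp_neg_div_one_sub_sq {p : ℝ} (hp : 0 < p) :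
    Real.exp (-p) / (1 - Real.exp (-p)) ^ 2 = 1 / Real.sinh (p / 2) ^ 2 / 4 := by
  have h1 : Real.exp (-p) = Real.exp (-(p / 2)) ^ 2 := by rw [← Real.exp_nat_mul]; congr 1; ring
  have h2 : Real.exp (p / 2) * Real.exp (-(p / 2)) = 1 := by rw [← Real.exp_add]; simp
  have h3 : 1 - Real.exp (-p) = 2 * Real.sinh (p / 2) * Real.exp (-(p / 2)) := by
    rw [Real.sinh_eq, h1]; linear_combination -h2
  have hs := (Real.sinh_pos_iff.2 (half_pos hp)).ne'
  rw [h3, h1]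
  field_simp
  norm_num

lemma hasSum_exp_neg_odd {a : ℝ} (ha : 0 < a) :
    HasSum (fun k : ℕ => Real.exp (-(a * (2 * k + 1)))) (1 / (2 * Real.sinh a)) := by
  have hlt : Real.exp (-(2 * a)) < 1 := Real.exp_lt_one_iff.2 (by linarith)
  have h := (hasSum_geometric_of_lt_one (Real.exp_nonneg _) hlt).mul_left (Real.exp (-a))
  have hk (k : ℕ) : Real.exp (-(a * (2 * k + 1))) = Real.exp (-a) * Real.exp (-(2 * a)) ^ k := by
    rw [← Real.exp_nat_mul, ← Real.exp_add]; congr 1; ring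
  have hv : 1 / (2 * Real.sinh a) = Real.exp (-a) * (1 - Real.exp (-(2 * a)))⁻¹ := by
    have h1 : 1 - Real.exp (-(2 * a)) = 2 * Real.sinh a * Real.exp (-a) := by
      have h2 : Real.exp a * Real.exp (-a) = 1 := by rw [← Real.exp_add]; simp
      have h3 : Real.exp (-(2 * a)) = Real.exp (-a) ^ 2 := by
        rw [← Real.exp_nat_mul]; congr 1; push_cast; ring
      rw [Real.sinh_eq, h3]; linear_combination -h2
    have hs := (Real.sinh_pos_iff.2 ha).ne'
    rw [h1]
    field_simp
  simpa only [hk, hv] using h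

theorem stmt_12 (α : ℝ) (hα : Real.log 2 / π < α) :
    ∫ x in (0:ℝ)..(π/2),
        (Real.cos (2*x) * Real.sin (Real.log (2 * Real.cos x) / α))
          / (Real.cosh (x/α) + Real.cos (Real.log (2 * Real.cos x) / α))
      = π / (8*α) - π*α / (4 * Real.sinh (π*α))
        - (π*α/8) * ∑' n : ℕ, 1 / (Real.sinh (π*α*(2*n+1)/2))^2 := by
  have h₀ : Real.log 2 < π * α := by rwa [div_lt_iff₀' Real.pi_pos] at hα
  have hα0 : 0 < α := (div_pos (Real.log_pos one_lt_two) Real.pi_pos).trans hα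
  have hπα : 0 < π * α := mul_pos Real.pi_pos hα0
  have hI := hasSum_integral_polePair hα0 h₀
  have hint : ∫ x in (0:ℝ)..(π/2),
        (Real.cos (2*x) * Real.sin (Real.log (2 * Real.cos x) / α))
          / (Real.cosh (x/α) + Real.cos (Real.log (2 * Real.cos x) / α)) =
      ∫ x in (0 : ℝ)..π / 2, Real.cos (2 * x) * (Complex.tan (logCurve x / (2 * α))).re := by
    refine intervalIntegral.integral_congr fun x _ => ?_
    simp only [re_tan_logCurve_eq hα0, mul_div_assoc]
  rw [hint]
  set J := ∫ x in (0 : ℝ)..π / 2, Real.cos (2 * x) * (Complex.tan (logCurve x / (2 * α))).re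
  have hA := hasSum_one_div_odd_sq.div_const ((π * α) ^ 2)
  have hB := hasSum_exp_neg_odd hπα
  have hterm (k : ℕ) : 1 / Real.sinh (π * α * (2 * k + 1) / 2) ^ 2 =
      8 * (1 / (2 * (k : ℝ) + 1) ^ 2 / (π * α) ^ 2 - Real.exp (-(π * α * (2 * k + 1))) / 2 -
        (∫ x in (0 : ℝ)..π / 2,
          4 * α * (Real.cos (2 * x) * (polePair (π * α * (2 * k + 1)) (logCurve x)).re)) /
            (π * α)) := by
    have hk : π * α ≤ π * α * (2 * k + 1) :=
      le_mul_of_one_le_right hπα.le (by linarith [k.cast_nonneg (α := ℝ)])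
    rw [intervalIntegral.integral_const_mul, integral_cos_two_mul_polePair (h₀.trans_le hk),
      exp_neg_div_one_sub_sq (hπα.trans_le hk), mul_pow (π * α)]
    have hs := (Real.sinh_pos_iff.2 (half_pos (hπα.trans_le hk))).ne'
    have := hα0.ne'
    field_simp
    ring
  have hS := ((hA.sub (hB.div_const 2)).sub (hI.div_const (π * α))).mul_left 8
  simp only [← hterm] at hS
  rw [hS.tsum_eq]
  have hs := (Real.sinh_pos_iff.2 hπα).ne'
  have := hα0.ne'
  field_simp
  ring
end

section
/- For every α > (ln 2)/π, ∫_0^π sinh((4x-π)/α) / (cosh((4x-π)/α) - cos(4 ln(2 sin x)/α)) dx = π·coth(π/(2α)) - πα/(4(√2 - 1)) - (πα/4)·Σ_{n=1}^∞ 1/(√2·cosh(παn/2) - 1). -/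
open Real

theorem im_cot_add_mul_I (A B : ℝ) :
    (Complex.cot (B + A * Complex.I)).im
      = -(Real.sinh (2 * A) / (Real.cosh (2 * A) - Real.cos (2 * B))) := by
  have hd : Real.cosh (2 * A) - Real.cos (2 * B)
      = 2 * ((Real.sin B * Real.cosh A) ^ 2 + (Real.cos B * Real.sinh A) ^ 2) := by
    rw [Real.cosh_two_mul, Real.cos_two_mul, mul_pow, mul_pow, Real.sin_sq, Real.cosh_sq]
    ring
  have hs : Complex.sin (B + A * Complex.I)
      = ⟨Real.sin B * Real.cosh A, Real.cos B * Real.sinh A⟩ := by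
    rw [Complex.sin_add_mul_I, Complex.mk_eq_add_mul_I]
    push_cast
    ring
  have hc : Complex.cos (B + A * Complex.I)
      = ⟨Real.cos B * Real.cosh A, -(Real.sin B * Real.sinh A)⟩ := by
    rw [Complex.cos_add_mul_I, Complex.mk_eq_add_mul_I]
    push_cast
    ring
  rw [Complex.cot, hs, hc, hd, Complex.div_im, Complex.normSq_mk, Real.sinh_two_mul]
  rw [← sub_div, mul_assoc 2, mul_div_mul_left _ _ two_ne_zero, ← neg_div]
  congr 1
  · linear_combination (-(Real.sinh A * Real.cosh A)) * Real.sin_sq_add_cos_sq B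
  · ring

theorem hasSum_div_sq_add_sq_of_pos {A : ℝ} (hA : 0 < A) (B : ℝ) :
    HasSum (fun k : ℤ => A / (A ^ 2 + (B - k * π) ^ 2))
      (Real.sinh (2 * A) / (Real.cosh (2 * A) - Real.cos (2 * B))) := by
  set t : ℤ → ℝ := fun k => A / (A ^ 2 + (B - k * π) ^ 2) with ht
  have t0 : ∀ k, 0 ≤ t k := fun k => by positivity
  set z : ℂ := (B + A * Complex.I) / π with hz
  have hπ : (π : ℂ) ≠ 0 := by exact_mod_cast pi_ne_zero
  have him (k : ℤ) : (1 / (z - k)).im = -(π * t k) := by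
    have h1 : 1 / (z - k) = π * ((⟨B - k * π, A⟩ : ℂ))⁻¹ := by
      have : z - k = (⟨B - k * π, A⟩ : ℂ) / π := by
        rw [hz, eq_div_iff hπ, sub_mul, div_mul_cancel₀ _ hπ]
        apply Complex.ext <;> simp
      rw [this, one_div_div, div_eq_mul_inv]
    rw [h1, Complex.im_ofReal_mul, Complex.inv_im, Complex.normSq_mk] 
    simp only [ht]
    rw [neg_div, mul_neg]
    congr 3
    ring
  have hzm : z ∈ Complex.integerComplement := by
    rintro ⟨k, hk⟩
    have := congrArg Complex.im hk
    simp [hz] at this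
    exact (div_pos hA pi_pos).ne this
  have hsum := (summable_cotTerm hzm).hasSum
  rw [show ∑' n, cotTerm z n = π * Complex.cot (π * z) - 1 / z from
    (cot_series_rep' hzm).symm] at hsum
  have hI := (Complex.hasSum_im hsum).mul_left (-π⁻¹)
  have hpair (n : ℕ) : -π⁻¹ * (cotTerm z n).im = t (n + 1) + t (-(n + 1)) := by
    have h1 := him (n + 1)
    have h2 := him (-(n + 1))
    push_cast at h1 h2
    rw [sub_neg_eq_add] at h2
    rw [cotTerm, Complex.add_im, h1, h2]
    field_simp
    ring
  have hval : -π⁻¹ * (π * Complex.cot (π * z) - 1 / z).im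
      = Real.sinh (2 * A) / (Real.cosh (2 * A) - Real.cos (2 * B)) - t 0 := by
    have h0 := him 0
    rw [Int.cast_zero, sub_zero] at h0
    rw [Complex.sub_im, h0, Complex.im_ofReal_mul, hz, mul_div_cancel₀ _ hπ, im_cot_add_mul_I]
    field_simp
    ring
  simp_rw [hpair] at hI
  rw [hval] at hI
  have s1 : Summable fun n : ℕ => t (n + 1) :=
    Summable.of_nonneg_of_le (fun n => t0 _) (fun n => le_add_of_nonneg_right (t0 _)) hI.summable
  have s2 : Summable fun n : ℕ => t (-(n + 1)) :=
    Summable.of_nonneg_of_le (fun n => t0 _) (fun n => le_add_of_nonneg_left (t0 _)) hI.summable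
  have h := s1.hasSum.of_add_one_of_neg_add_one s2.hasSum
  have e := (s1.hasSum.add s2.hasSum).unique hI
  convert h using 1
  linarith

theorem hasSum_div_sq_add_sq (A B : ℝ) :
    HasSum (fun k : ℤ => A / (A ^ 2 + (B - k * π) ^ 2))
      (Real.sinh (2 * A) / (Real.cosh (2 * A) - Real.cos (2 * B))) := by
  rcases lt_trichotomy A 0 with h | rfl | h
  · have := (hasSum_div_sq_add_sq_of_pos (neg_pos.2 h) B).neg
    simpa [neg_div] using this
  · simp
  · exact hasSum_div_sq_add_sq_of_pos h B

open Filter Topology Metric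

theorem one_sub_re_pos {z : ℂ} (hz : z ∈ closedBall (0 : ℂ) 1) (h1 : z ≠ 1) :
    0 < (1 - z).re := by
  rw [mem_closedBall_zero_iff] at hz
  have hn : z.re * z.re + z.im * z.im ≤ 1 := by
    rw [← Complex.normSq_apply, Complex.normSq_eq_norm_sq]
    nlinarith [norm_nonneg z]
  rw [Complex.sub_re, Complex.one_re, sub_pos]
  by_contra! h
  refine h1 (Complex.ext ?_ ?_)
  · rw [Complex.one_re]
    nlinarith [mul_self_nonneg z.im]
  · rw [Complex.one_im]
    exact mul_self_eq_zero.1 (by nlinarith [mul_self_nonneg z.im])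

theorem hasDerivAt_log_one_sub {z : ℂ} (hz : 0 < (1 - z).re) :
    HasDerivAt (fun z : ℂ => Complex.log (1 - z)) (-(1 - z)⁻¹) z := by
  have := ((hasDerivAt_id z).const_sub 1).clog (Or.inl hz)
  simpa [neg_div] using this

theorem tendsto_inv_log_one_sub_sub (c : ℂ) :
    Tendsto (fun z : ℂ => (Complex.log (1 - z) - c)⁻¹) (𝓝[≠] 1) (𝓝 0) := by
  have h1 : Tendsto (fun z : ℂ => ‖1 - z‖) (𝓝[≠] 1) (𝓝[>] 0) := by
    refine tendsto_nhdsWithin_iff.2 ⟨?_, ?_⟩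
    · have : Continuous fun z : ℂ => ‖1 - z‖ := by fun_prop
      simpa using (this.tendsto 1).mono_left nhdsWithin_le_nhds
    · filter_upwards [self_mem_nhdsWithin] with z hz
      exact norm_pos_iff.2 (sub_ne_zero.2 (Ne.symm hz))
  have h2 : Tendsto (fun z : ℂ => (Complex.log (1 - z) - c).re) (𝓝[≠] 1) atBot := by
    simp_rw [Complex.sub_re, Complex.log_re]
    exact tendsto_atBot_add_const_right _ _ (Real.tendsto_log_nhdsGT_zero.comp h1)
  refine tendsto_inv₀_cobounded.comp ?_
  rw [← tendsto_norm_atTop_iff_cobounded]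
  exact tendsto_atTop_mono (fun z => Complex.abs_re_le_norm _) (tendsto_abs_atBot_atTop.comp h2)

theorem exp_mul_I_ne_one {θ : ℝ} (hθ : θ ∈ Set.Ioo 0 (2 * π)) :
    Complex.exp (θ * Complex.I) ≠ 1 := by
  rw [Ne, Complex.exp_eq_one_iff]
  rintro ⟨n, hn⟩
  have h2 := congrArg Complex.im hn
  simp at h2
  have p := pi_pos
  have h0 : (0 : ℝ) < n := by
    by_contra! h
    nlinarith [hθ.1]
  have h1 : (n : ℝ) < 1 := by
    by_contra! h
    nlinarith [hθ.2]
  norm_cast at h0 h1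
  lia

theorem circleIntegral_inv_smul_eq {f g : ℂ → ℂ} (h : ∀ z ∈ sphere (0 : ℂ) 1, z ≠ 1 → f z = g z) :
    (∮ z in C(0, 1), z⁻¹ • f z)
      = Complex.I * ∫ θ in (0 : ℝ)..2 * π, g (Complex.exp (θ * Complex.I)) := by
  rw [circleIntegral, ← intervalIntegral.integral_const_mul]
  refine intervalIntegral.integral_congr_Ioo_of_le two_pi_pos.le fun θ hθ => ?_
  have hs := exp_mul_I_ne_one hθ
  have hf := h (Complex.exp (θ * Complex.I)) (by simp [Complex.norm_exp_ofReal_mul_I]) hs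
  simp only [deriv_circleMap, circleMap, smul_eq_mul, zero_add, Complex.ofReal_one, one_mul, hf]
  field_simp [Complex.exp_ne_zero]

theorem integral_inv_log_one_sub_sub {c : ℂ}
    (h : ∀ z ∈ closedBall (0 : ℂ) 1, z ≠ 1 → Complex.log (1 - z) ≠ c) :
    ∫ θ in (0 : ℝ)..2 * π, (Complex.log (1 - Complex.exp (θ * Complex.I)) - c)⁻¹
      = 2 * π * (-c)⁻¹ := by
  set f : ℂ → ℂ := Function.update (fun z => (Complex.log (1 - z) - c)⁻¹) 1 0 with hf
  have hne {z : ℂ} (hz : z ≠ 1) : f z = (Complex.log (1 - z) - c)⁻¹ :=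
    Function.update_of_ne hz _ _
  have hd (z : ℂ) (hz : z ∈ closedBall (0 : ℂ) 1) (h1 : z ≠ 1) : DifferentiableAt ℂ f z := by
    have h2 := ((hasDerivAt_log_one_sub (one_sub_re_pos hz h1)).sub_const c).inv
      (sub_ne_zero.2 (h z hz h1))
    refine h2.differentiableAt.congr_of_eventuallyEq ?_
    filter_upwards [isOpen_ne.mem_nhds h1] with w hw using hne hw
  have hcont : ContinuousOn f (closedBall 0 1) := by
    intro z hz
    by_cases h1 : z = 1
    · rw [h1]
      exact (continuousAt_update_same.2 (tendsto_inv_log_one_sub_sub c)).continuousWithinAt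
    · exact (hd z hz h1).continuousAt.continuousWithinAt
  have key := Complex.circleIntegral_sub_inv_smul_of_differentiable_on_off_countable
    (Set.countable_singleton (1 : ℂ)) (mem_ball_self one_pos) hcont
    (fun z hz => hd z (ball_subset_closedBall hz.1) hz.2)
  simp_rw [sub_zero] at key
  rw [circleIntegral_inv_smul_eq (fun z _ h1 => hne h1), hne zero_ne_one, sub_zero,
    Complex.log_one, zero_sub, smul_eq_mul] at key
  refine mul_left_cancel₀ Complex.I_ne_zero (key.trans ?_)
  ring

theorem integral_inv_log_one_sub_sub_of_mem {c : ℂ} (hlog : Complex.log (Complex.exp c) = c)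
    (hc : c ≠ 0) (hw : ‖1 - Complex.exp c‖ < 1) :
    ∫ θ in (0 : ℝ)..2 * π, (Complex.log (1 - Complex.exp (θ * Complex.I)) - c)⁻¹
      = 2 * π * ((-c)⁻¹ - Complex.exp c / (1 - Complex.exp c)) := by
  set w : ℂ := 1 - Complex.exp c with hwd
  have hew : Complex.exp c = 1 - w := by rw [hwd]; ring
  have hlw : Complex.log (1 - w) = c := by rw [← hew, hlog]
  have hw0 : w ≠ 0 := by
    intro h
    rw [h, sub_zero, Complex.log_one] at hlw
    exact hc hlw.symm
  have hw1 : w ≠ 1 := by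
    rintro h
    rw [h] at hw
    simp at hw
  have hwb : w ∈ ball (0 : ℂ) 1 := mem_ball_zero_iff.2 hw
  have hwre := one_sub_re_pos (ball_subset_closedBall hwb) hw1
  have hne {z : ℂ} (hz : z ≠ 1) (hzw : z ≠ w) : Complex.log (1 - z) ≠ c := by
    intro h
    have := congrArg Complex.exp h
    rw [Complex.exp_log (sub_ne_zero.2 hz.symm), hew] at this
    exact hzw (sub_right_injective this)
  set f₀ : ℂ → ℂ := Function.update (fun z => (z - w) * (Complex.log (1 - z) - c)⁻¹) 1 0 with hf₀
  set f : ℂ → ℂ := Function.update f₀ w (-(1 - w)) with hf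
  have hfne {z : ℂ} (hz : z ≠ 1) (hzw : z ≠ w) :
      f z = (z - w) * (Complex.log (1 - z) - c)⁻¹ := by
    rw [hf, Function.update_of_ne hzw, hf₀, Function.update_of_ne hz]
  have hfw : f w = -(1 - w) := Function.update_self _ _ _
  have hd (z : ℂ) (hz : z ∈ closedBall (0 : ℂ) 1) (h1 : z ≠ 1) (hzw : z ≠ w) :
      DifferentiableAt ℂ f z := by
    have h2 := ((hasDerivAt_log_one_sub (one_sub_re_pos hz h1)).sub_const c).inv
      (sub_ne_zero.2 (hne h1 hzw))
    refine ((differentiableAt_id.sub_const w).mul h2.differentiableAt).congr_of_eventuallyEq ?_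
    filter_upwards [isOpen_ne.mem_nhds h1, isOpen_ne.mem_nhds hzw] with u hu huw using hfne hu huw
  have hcont : ContinuousOn f (closedBall 0 1) := by
    intro z hz
    by_cases h1 : z = 1
    · rw [h1]
      have : ContinuousAt f₀ 1 := by
        rw [hf₀, continuousAt_update_same]
        have h3 : Tendsto (fun z : ℂ => z - w) (𝓝[≠] 1) (𝓝 (1 - w)) :=
          ((continuous_sub_right w).tendsto 1).mono_left nhdsWithin_le_nhds
        simpa using h3.mul (tendsto_inv_log_one_sub_sub c)
      exact ((continuousAt_update_of_ne hw1.symm).2 this).continuousWithinAt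
    by_cases hzw : z = w
    · rw [hzw]
      refine (continuousAt_update_same.2 ?_).continuousWithinAt
      have h3 := (hasDerivAt_iff_tendsto_slope.1 (hasDerivAt_log_one_sub hwre)).inv₀
        (neg_ne_zero.2 (inv_ne_zero (sub_ne_zero.2 hw1.symm)))
      rw [inv_neg, inv_inv] at h3
      refine h3.congr' ?_
      filter_upwards [nhdsWithin_le_nhds (isOpen_ne.mem_nhds hw1)] with u hu
      rw [slope_def_field, inv_div, hlw, hf₀, Function.update_of_ne hu, div_eq_mul_inv]
    · exact (hd z hz h1 hzw).continuousAt.continuousWithinAt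
  have hcd : ∀ z ∈ ball (0 : ℂ) 1 \ {1, w}, DifferentiableAt ℂ f z := fun z hz =>
    hd z (ball_subset_closedBall hz.1) (fun h => hz.2 (Or.inl h)) (fun h => hz.2 (Or.inr h))
  have hcount : ({1, w} : Set ℂ).Countable := (Set.toFinite _).countable
  have k0 := Complex.circleIntegral_sub_inv_smul_of_differentiable_on_off_countable
    hcount (mem_ball_self one_pos) hcont hcd
  have k1 := Complex.circleIntegral_sub_inv_smul_of_differentiable_on_off_countable
    hcount hwb hcont hcd
  have hint {u : ℂ} (hu : u ∈ ball (0 : ℂ) 1) :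
      CircleIntegrable (fun z => (z - u)⁻¹ • f z) 0 1 := by
    refine ContinuousOn.circleIntegrable zero_le_one ?_
    refine ContinuousOn.smul (ContinuousOn.inv₀ (continuous_sub_right u).continuousOn ?_)
      (hcont.mono sphere_subset_closedBall)
    intro z hz h
    rw [sub_eq_zero.1 h] at hz
    exact (mem_ball.1 hu).ne (mem_sphere.1 hz)
  have ks := circleIntegral.integral_sub (hint hwb) (hint (mem_ball_self one_pos))
  have hsub : (∮ z in C(0, 1), ((z - w)⁻¹ • f z - (z - 0)⁻¹ • f z))
      = ∮ z in C(0, 1), z⁻¹ • (w * ((z - w)⁻¹ * f z)) := by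
    refine circleIntegral.integral_congr zero_le_one fun z hz => ?_
    have hz0 : z ≠ 0 := by
      rintro rfl
      simp at hz
    have hzw : z - w ≠ 0 := by
      intro h
      rw [sub_eq_zero.1 h] at hz
      exact (mem_ball.1 hwb).ne (mem_sphere.1 hz)
    simp only [smul_eq_mul, sub_zero]
    field_simp
    ring
  have hcirc : (∮ z in C(0, 1), z⁻¹ • (w * ((z - w)⁻¹ * f z))) = Complex.I *
      ∫ θ in (0 : ℝ)..2 * π, w * (Complex.log (1 - Complex.exp (θ * Complex.I)) - c)⁻¹ := by
    refine circleIntegral_inv_smul_eq (g := fun z => w * (Complex.log (1 - z) - c)⁻¹)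
      fun z hz h1 => ?_
    have hzw : z ≠ w := by
      rintro rfl
      exact (mem_ball.1 hwb).ne (mem_sphere.1 hz)
    rw [hfne h1 hzw, inv_mul_cancel_left₀ (sub_ne_zero.2 hzw)]
  rw [← hsub, ks, k0, k1, intervalIntegral.integral_const_mul, hfw, hfne zero_ne_one hw0.symm,
    sub_zero, Complex.log_one] at hcirc
  refine mul_left_cancel₀ (mul_ne_zero Complex.I_ne_zero hw0) ?_
  rw [mul_assoc, ← hcirc, hew]
  simp only [smul_eq_mul]
  field_simp
  ring

theorem intervalIntegrable_inv_log_one_sub_sub {c : ℂ}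
    (h : ∀ z ∈ sphere (0 : ℂ) 1, z ≠ 1 → Complex.log (1 - z) ≠ c) :
    IntervalIntegrable (fun θ : ℝ => (Complex.log (1 - Complex.exp (θ * Complex.I)) - c)⁻¹)
      MeasureTheory.volume 0 (2 * π) := by
  set f : ℂ → ℂ := Function.update (fun z => (Complex.log (1 - z) - c)⁻¹) 1 0 with hf
  have hne {z : ℂ} (hz : z ≠ 1) : f z = (Complex.log (1 - z) - c)⁻¹ :=
    Function.update_of_ne hz _ _
  have hcont : ContinuousOn f (sphere 0 1) := by
    intro z hz
    by_cases h1 : z = 1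
    · rw [h1]
      exact (continuousAt_update_same.2 (tendsto_inv_log_one_sub_sub c)).continuousWithinAt
    · have h2 := ((hasDerivAt_log_one_sub (one_sub_re_pos (sphere_subset_closedBall hz)
        h1)).sub_const c).inv (sub_ne_zero.2 (h z hz h1))
      refine (h2.continuousAt.congr ?_).continuousWithinAt
      filter_upwards [isOpen_ne.mem_nhds h1] with w hw using (hne hw).symm
  have hi : IntervalIntegrable (fun θ => f (circleMap 0 1 θ)) MeasureTheory.volume 0 (2 * π) :=
    hcont.circleIntegrable zero_le_one
  refine hi.congr_uIoo fun θ hθ => ?_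
  rw [Set.uIoo_of_le two_pi_pos.le] at hθ
  simp only [circleMap, zero_add, Complex.ofReal_one, one_mul]
  exact hne (exp_mul_I_ne_one hθ)

theorem log_one_sub_exp_two_mul_I {x : ℝ} (hx : x ∈ Set.Ioo 0 π) :
    Complex.log (1 - Complex.exp ((2 * x : ℝ) * Complex.I))
      = ⟨Real.log (2 * Real.sin x), x - π / 2⟩ := by
  have hs : 0 < 2 * Real.sin x := mul_pos two_pos (Real.sin_pos_of_mem_Ioo hx)
  have h : 1 - Complex.exp ((2 * x : ℝ) * Complex.I)
      = Complex.exp ⟨Real.log (2 * Real.sin x), x - π / 2⟩ := by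
    have h2 := Real.sin_sq_add_cos_sq x
    apply Complex.ext
    · rw [Complex.exp_re, Real.exp_log hs, Real.cos_sub_pi_div_two, Complex.sub_re,
        Complex.exp_ofReal_mul_I_re, Real.cos_two_mul, Complex.one_re]
      linear_combination -2 * h2
    · rw [Complex.exp_im, Real.exp_log hs, Real.sin_sub_pi_div_two, Complex.sub_im,
        Complex.exp_ofReal_mul_I_im, Real.sin_two_mul, Complex.one_im]
      ring
  rw [h, Complex.log_exp]
  · linarith [hx.1, pi_pos]
  · linarith [hx.2, pi_pos]

theorem integral_div_sq_add_log_two_mul_sin_sub_sq {t : ℝ} {V : ℂ}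
    (h : ∀ z ∈ sphere (0 : ℂ) 1, z ≠ 1 → Complex.log (1 - z) ≠ ⟨t, -(π / 4)⟩)
    (hV : ∫ θ in (0 : ℝ)..2 * π,
      (Complex.log (1 - Complex.exp (θ * Complex.I)) - ⟨t, -(π / 4)⟩)⁻¹ = 2 * π * V) :
    ∫ x in (0 : ℝ)..π, (x - π / 4) / ((x - π / 4) ^ 2 + (Real.log (2 * Real.sin x) - t) ^ 2)
      = -(π * V.im) := by
  have h1 := Complex.imCLM.intervalIntegral_comp_comm (intervalIntegrable_inv_log_one_sub_sub h)
  rw [hV] at h1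
  have h2 := intervalIntegral.integral_comp_mul_left (a := 0) (b := π) (c := 2)
    (fun θ : ℝ => Complex.imCLM
      (Complex.log (1 - Complex.exp (θ * Complex.I)) - ⟨t, -(π / 4)⟩)⁻¹) two_ne_zero
  rw [mul_zero, h1] at h2
  have h3 : ∫ x in (0 : ℝ)..π,
      (x - π / 4) / ((x - π / 4) ^ 2 + (Real.log (2 * Real.sin x) - t) ^ 2)
      = ∫ x in (0 : ℝ)..π, -Complex.imCLM
      (Complex.log (1 - Complex.exp ((2 * x : ℝ) * Complex.I)) - ⟨t, -(π / 4)⟩)⁻¹ := by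
    refine intervalIntegral.integral_congr_Ioo_of_le pi_pos.le fun x hx => ?_
    rw [log_one_sub_exp_two_mul_I hx, Complex.imCLM_apply, Complex.inv_im, Complex.normSq_apply,
      Complex.sub_re, Complex.sub_im, neg_div, neg_neg]
    congr 1 <;> ring
  have h4 : (2 * π * V : ℂ).im = 2 * (π * V.im) := by
    rw [mul_assoc, ← Complex.ofReal_ofNat, Complex.im_ofReal_mul, Complex.im_ofReal_mul]
  rw [h3, intervalIntegral.integral_neg, h2, Complex.imCLM_apply, h4, smul_eq_mul]
  ring

theorem inv_neg_mk_im (t : ℝ) :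
    ((-(⟨t, -(π / 4)⟩ : ℂ))⁻¹).im = -((π / 4) / ((π / 4) ^ 2 + t ^ 2)) := by
  rw [Complex.inv_im, Complex.normSq_apply]
  simp only [Complex.neg_re, Complex.neg_im, neg_neg, neg_div]
  congr 2
  ring

theorem exp_mk_neg_pi_div_four (t : ℝ) :
    Complex.exp ⟨t, -(π / 4)⟩
      = ⟨Real.exp t * (Real.sqrt 2 / 2), -(Real.exp t * (Real.sqrt 2 / 2))⟩ := by
  apply Complex.ext
  · simp [Complex.exp_re]
  · simp [Complex.exp_im]

theorem normSq_one_sub_exp (t : ℝ) :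
    Complex.normSq (1 - Complex.exp ⟨t, -(π / 4)⟩)
      = 1 - Real.sqrt 2 * Real.exp t + Real.exp t ^ 2 := by
  rw [exp_mk_neg_pi_div_four, Complex.normSq_apply]
  simp only [Complex.sub_re, Complex.one_re, Complex.sub_im, Complex.one_im]
  linear_combination (Real.exp t ^ 2 / 2) * Real.sq_sqrt (zero_le_two (α := ℝ))

theorem exp_div_one_sub_exp_im (t : ℝ) :
    (Complex.exp ⟨t, -(π / 4)⟩ / (1 - Complex.exp ⟨t, -(π / 4)⟩)).im
      = -(1 / 2 / (Real.sqrt 2 * Real.cosh t - 1)) := by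
  have h2 := Real.sq_sqrt (zero_le_two (α := ℝ))
  have h1 : 1 < Real.sqrt 2 := by
    rw [Real.lt_sqrt] <;> norm_num
  have he := Real.exp_pos t
  have hD : 0 < 1 - Real.sqrt 2 * Real.exp t + Real.exp t ^ 2 := by
    nlinarith [sq_nonneg (Real.exp t - Real.sqrt 2 / 2)]
  have hC : 0 < Real.sqrt 2 * Real.cosh t - 1 := by
    nlinarith [Real.one_le_cosh t]
  have hc : Real.exp t * Real.cosh t = (Real.exp t ^ 2 + 1) / 2 := by
    rw [Real.cosh_eq, Real.exp_neg]
    field_simp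
  rw [Complex.div_im, normSq_one_sub_exp, exp_mk_neg_pi_div_four]
  simp only [Complex.sub_re, Complex.one_re, Complex.sub_im, Complex.one_im]
  rw [← sub_div, ← neg_div, div_eq_div_iff hD.ne' hC.ne']
  linear_combination (-1) * hc + (-(Real.exp t * Real.cosh t) / 2) * h2

theorem log_one_sub_ne_of_one_lt_normSq {t : ℝ}
    (ht : 1 < Complex.normSq (1 - Complex.exp ⟨t, -(π / 4)⟩)) :
    ∀ z ∈ closedBall (0 : ℂ) 1, z ≠ 1 → Complex.log (1 - z) ≠ ⟨t, -(π / 4)⟩ := by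
  intro z hz h1 h
  rw [← h, Complex.exp_log (sub_ne_zero.2 h1.symm), sub_sub_cancel, Complex.normSq_eq_norm_sq] at ht
  rw [mem_closedBall_zero_iff] at hz
  nlinarith [norm_nonneg z]

theorem integral_div_sq_add_log_two_mul_sin_sub_sq_of_half_log_two_lt {t : ℝ}
    (ht : Real.log 2 / 2 < t) :
    ∫ x in (0 : ℝ)..π, (x - π / 4) / ((x - π / 4) ^ 2 + (Real.log (2 * Real.sin x) - t) ^ 2)
      = π * ((π / 4) / ((π / 4) ^ 2 + t ^ 2)) := by
  have he : Real.sqrt 2 < Real.exp t := by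
    rw [← Real.log_lt_iff_lt_exp (by positivity), Real.log_sqrt zero_le_two]
    exact ht
  have hN : 1 < Complex.normSq (1 - Complex.exp ⟨t, -(π / 4)⟩) := by
    rw [normSq_one_sub_exp]
    nlinarith [Real.exp_pos t]
  have h := log_one_sub_ne_of_one_lt_normSq hN
  rw [integral_div_sq_add_log_two_mul_sin_sub_sq
    (fun z hz => h z (sphere_subset_closedBall hz)) (integral_inv_log_one_sub_sub h),
    inv_neg_mk_im]
  ring

theorem integral_div_sq_add_log_two_mul_sin_sub_sq_of_nonpos {t : ℝ} (ht : t ≤ 0) :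
    ∫ x in (0 : ℝ)..π, (x - π / 4) / ((x - π / 4) ^ 2 + (Real.log (2 * Real.sin x) - t) ^ 2)
      = π * ((π / 4) / ((π / 4) ^ 2 + t ^ 2) - 1 / 2 / (Real.sqrt 2 * Real.cosh t - 1)) := by
  have p := pi_pos
  have he : Real.exp t ≤ 1 := Real.exp_le_one_iff.2 ht
  have h1 : 1 < Real.sqrt 2 := by
    rw [Real.lt_sqrt] <;> norm_num
  have hN : Complex.normSq (1 - Complex.exp ⟨t, -(π / 4)⟩) < 1 := by
    rw [normSq_one_sub_exp]
    nlinarith [Real.exp_pos t]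
  have hlog : Complex.log (Complex.exp ⟨t, -(π / 4)⟩) = ⟨t, -(π / 4)⟩ :=
    Complex.log_exp (by simp only; linarith) (by simp only; linarith)
  have hc : (⟨t, -(π / 4)⟩ : ℂ) ≠ 0 := fun h => by
    have := congrArg Complex.im h
    simp only [Complex.zero_im] at this
    linarith
  have hnorm : ‖1 - Complex.exp ⟨t, -(π / 4)⟩‖ < 1 := by
    rw [Complex.normSq_eq_norm_sq] at hN
    nlinarith [norm_nonneg (1 - Complex.exp ⟨t, -(π / 4)⟩)]
  have h : ∀ z ∈ sphere (0 : ℂ) 1, z ≠ 1 → Complex.log (1 - z) ≠ ⟨t, -(π / 4)⟩ := by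
    intro z hz h1 h
    rw [← h, Complex.exp_log (sub_ne_zero.2 h1.symm), sub_sub_cancel] at hnorm
    exact hnorm.ne (mem_sphere_zero_iff_norm.1 hz)
  rw [integral_div_sq_add_log_two_mul_sin_sub_sq h
    (integral_inv_log_one_sub_sub_of_mem hlog hc hnorm), Complex.sub_im, inv_neg_mk_im,
    exp_div_one_sub_exp_im]
  ring

theorem intervalIntegrable_sinh_div_cosh_sub_cos {α : ℝ} (hα : Real.log 2 / π < α) :
    IntervalIntegrable (fun x : ℝ => Real.sinh (2 * |2 / α * (x - π / 4)|)
      / (Real.cosh (2 * |2 / α * (x - π / 4)|)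
        - Real.cos (2 * (2 / α * Real.log (2 * Real.sin x))))) MeasureTheory.volume 0 π := by
  have p := pi_pos
  have hα0 : 0 < α := lt_trans (by positivity) hα
  have hl : Real.log 2 < α * π := (div_lt_iff₀ p).1 hα
  have hl0 : 0 < Real.log 2 := Real.log_pos one_lt_two
  set f : ℝ → ℝ := fun x => Real.sinh (2 * |2 / α * (x - π / 4)|)
      / (Real.cosh (2 * |2 / α * (x - π / 4)|)
        - Real.cos (2 * (2 / α * Real.log (2 * Real.sin x)))) with hf
  have hmeas : Measurable f := by fun_prop
  have hcont : ContinuousOn f (Set.Icc (π / 8) (3 * π / 8)) := by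
    have hs : ∀ x ∈ Set.Icc (π / 8) (3 * π / 8), 2 * Real.sin x ≠ 0 := fun x hx =>
      (mul_pos two_pos (Real.sin_pos_of_pos_of_lt_pi (by linarith [hx.1])
        (by linarith [hx.2]))).ne'
    refine ContinuousOn.div (by fun_prop) (by fun_prop (disch := assumption)) ?_
    intro x hx h
    have hcos := Real.cos_le_one (2 * (2 / α * Real.log (2 * Real.sin x)))
    have hx4 : x = π / 4 := by
      by_contra hne
      have : 2 * |2 / α * (x - π / 4)| ≠ 0 := by
        have := sub_ne_zero.2 hne
        positivity
      linarith [Real.one_lt_cosh.2 this]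
    have h2 : Real.log (2 * Real.sin x) = Real.log 2 / 2 := by
      rw [hx4, Real.sin_pi_div_four, mul_div_cancel₀ _ (two_ne_zero), Real.log_sqrt zero_le_two]
    have h3 : 2 * (2 / α * (Real.log 2 / 2)) = 2 * (Real.log 2 / α) := by ring
    have h4 : Real.log 2 / α < π := (div_lt_iff₀ hα0).2 (by linarith)
    have h5 : 0 < Real.log 2 / α := by positivity
    rw [h2, h3, hx4, sub_self, mul_zero, abs_zero, mul_zero, Real.cosh_zero, sub_eq_zero] at h
    have := (Real.cos_eq_one_iff_of_lt_of_lt (by linarith) (by linarith)).1 h.symm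
    linarith
  obtain ⟨C, hC⟩ := isCompact_Icc.exists_bound_of_continuousOn hcont
  set D : ℝ := Real.sinh (2 * (2 / α * π)) / (Real.cosh (2 * (2 / α * (π / 8))) - 1) with hD
  rw [intervalIntegrable_iff_integrableOn_Ioc_of_le p.le]
  refine MeasureTheory.Measure.integrableOn_of_bounded (M := max C D) (by simp)
    hmeas.aestronglyMeasurable ?_
  filter_upwards [MeasureTheory.ae_restrict_mem measurableSet_Ioc] with x hx
  by_cases hx' : x ∈ Set.Icc (π / 8) (3 * π / 8)
  · exact (hC x hx').trans (le_max_left _ _)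
  refine le_trans ?_ (le_max_right _ _)
  have hlow : π / 8 ≤ |x - π / 4| := by
    rw [Set.mem_Icc, not_and_or, not_le, not_le] at hx'
    rcases hx' with h | h
    · exact le_abs.2 (Or.inr (by linarith))
    · exact le_abs.2 (Or.inl (by linarith))
  have hup : |x - π / 4| ≤ π := abs_le.2 ⟨by linarith [hx.1], by linarith [hx.2]⟩
  have habs : |2 / α * (x - π / 4)| = 2 / α * |x - π / 4| := by
    rw [abs_mul, abs_of_pos (by positivity)]
  have hpos : 0 < Real.cosh (2 * (2 / α * (π / 8))) - 1 := by
    rw [sub_pos, Real.one_lt_cosh]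
    positivity
  have hden : Real.cosh (2 * (2 / α * (π / 8))) - 1 ≤ Real.cosh (2 * |2 / α * (x - π / 4)|)
      - Real.cos (2 * (2 / α * Real.log (2 * Real.sin x))) := by
    refine sub_le_sub (Real.cosh_le_cosh.2 ?_) (Real.cos_le_one _)
    rw [abs_of_nonneg (by positivity), abs_of_nonneg (by positivity), habs]
    gcongr
  rw [hf, Real.norm_of_nonneg]
  · refine div_le_div₀ (Real.sinh_nonneg_iff.2 (by positivity)) (Real.sinh_le_sinh.2 ?_) hpos hden
    rw [habs]
    gcongr
  · exact div_nonneg (Real.sinh_nonneg_iff.2 (by positivity)) (hpos.le.trans hden)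

theorem hasSum_integral_div_sq_add_sq {α : ℝ} (hα : Real.log 2 / π < α) :
    HasSum (fun k : ℤ => ∫ x in (0 : ℝ)..π, 2 / α * (x - π / 4) / ((2 / α * (x - π / 4)) ^ 2
        + (2 / α * Real.log (2 * Real.sin x) - k * π) ^ 2))
      (∫ x in (0 : ℝ)..π, Real.sinh ((4 * x - π) / α)
        / (Real.cosh ((4 * x - π) / α) - Real.cos (4 * Real.log (2 * Real.sin x) / α))) := by
  refine intervalIntegral.hasSum_integral_of_dominated_convergence
    (fun k x => |2 / α * (x - π / 4)| / (|2 / α * (x - π / 4)| ^ 2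
        + (2 / α * Real.log (2 * Real.sin x) - k * π) ^ 2)) ?_ ?_ ?_ ?_ ?_
  · intro k
    exact Measurable.aestronglyMeasurable (by fun_prop)
  · refine fun k => MeasureTheory.ae_of_all _ fun x _ => ?_
    rw [Real.norm_eq_abs, abs_div, sq_abs, abs_of_nonneg (a := _ + _) (by positivity)]
  · exact MeasureTheory.ae_of_all _ fun x _ => (hasSum_div_sq_add_sq _ _).summable
  · simp_rw [(hasSum_div_sq_add_sq _ _).tsum_eq]
    exact intervalIntegrable_sinh_div_cosh_sub_cos hα
  · refine MeasureTheory.ae_of_all _ fun x _ => ?_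
    rw [show (4 * x - π) / α = 2 * (2 / α * (x - π / 4)) by ring,
      show 4 * Real.log (2 * Real.sin x) / α = 2 * (2 / α * Real.log (2 * Real.sin x)) by ring]
    exact hasSum_div_sq_add_sq _ _

theorem stmt_14 (α : ℝ) (hα : Real.log 2 / π < α) :
    ∫ x in (0:ℝ)..π,
        Real.sinh ((4*x - π)/α)
          / (Real.cosh ((4*x - π)/α) - Real.cos (4 * Real.log (2 * Real.sin x) / α))
      = π * (1 / Real.tanh (π/(2*α))) - π*α / (4 * (Real.sqrt 2 - 1))
        - (π*α/4) * ∑' n : ℕ, 1 / (Real.sqrt 2 * Real.cosh (π*α*(n+1)/2) - 1) := by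
  have p := pi_pos
  have hl0 : 0 < Real.log 2 := Real.log_pos one_lt_two
  have hα0 : 0 < α := lt_trans (by positivity) hα
  have hl : Real.log 2 < α * π := (div_lt_iff₀ p).1 hα
  set J := ∫ x in (0:ℝ)..π,
        Real.sinh ((4*x - π)/α)
          / (Real.cosh ((4*x - π)/α) - Real.cos (4 * Real.log (2 * Real.sin x) / α)) with hJ
  set R : ℝ → ℝ := fun t => 1 / (Real.sqrt 2 * Real.cosh t - 1) with hR
  set P : ℤ → ℝ := fun k =>
    π / (2 * α) / ((π / (2 * α)) ^ 2 + (0 - k * π) ^ 2) with hP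
  have hterm (k : ℤ) : ∫ x in (0 : ℝ)..π, 2 / α * (x - π / 4) / ((2 / α * (x - π / 4)) ^ 2
        + (2 / α * Real.log (2 * Real.sin x) - k * π) ^ 2)
      = π * P k - π * α / 4 * (if k ≤ 0 then R (π * α * k / 2) else 0) := by
    have e1 (q u : ℝ) : 2 / α * q / ((2 / α * q) ^ 2 + (2 / α * u - k * π) ^ 2)
        = α / 2 * (q / (q ^ 2 + (u - π * α * k / 2) ^ 2)) := by
      have : (2 / α * q) ^ 2 + (2 / α * u - k * π) ^ 2
          = (2 / α) ^ 2 * (q ^ 2 + (u - π * α * k / 2) ^ 2) := by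
        field_simp
      rw [this, sq (2 / α), mul_assoc, mul_div_mul_left _ _ (by positivity), ← inv_div 2 α,
        mul_comm (2 / α), div_mul_eq_div_div, div_eq_inv_mul]
    have e2 : P k = α / 2 * (π / 4 / ((π / 4) ^ 2 + (π * α * k / 2) ^ 2)) := by
      have := e1 (π / 4) 0
      rw [mul_zero, zero_sub (π * α * k / 2), neg_sq,
        show 2 / α * (π / 4) = π / (2 * α) by field_simp; norm_num] at this
      exact this
    simp_rw [e1]
    rw [intervalIntegral.integral_const_mul, e2]
    split_ifs with hk
    · have hk' : (k : ℝ) ≤ 0 := by exact_mod_cast hk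
      rw [integral_div_sq_add_log_two_mul_sin_sub_sq_of_nonpos (div_nonpos_of_nonpos_of_nonneg
        (mul_nonpos_of_nonneg_of_nonpos (by positivity) hk') zero_le_two)]
      simp only [hR]
      ring
    · have hk' : (1 : ℝ) ≤ k := by exact_mod_cast (by lia : 1 ≤ k)
      rw [integral_div_sq_add_log_two_mul_sin_sub_sq_of_half_log_two_lt
        (by nlinarith [mul_pos p hα0])]
      ring
  have h1 := hasSum_integral_div_sq_add_sq hα
  simp_rw [hterm] at h1
  rw [← hJ] at h1
  have h2 : HasSum P (1 / Real.tanh (π / (2 * α))) := by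
    have h := hasSum_div_sq_add_sq (π / (2 * α)) 0
    have hs : Real.sinh (π / (2 * α)) ≠ 0 := (Real.sinh_pos_iff.2 (by positivity)).ne'
    have hc := (Real.cosh_pos (π / (2 * α))).ne'
    convert h using 1
    generalize π / (2 * α) = A at hs hc ⊢
    rw [mul_zero, Real.cos_zero, Real.sinh_two_mul, Real.cosh_two_mul, Real.cosh_sq,
      Real.tanh_eq_sinh_div_cosh]
    have e : Real.sinh A ^ 2 + 1 + Real.sinh A ^ 2 - 1 = 2 * Real.sinh A ^ 2 := by ring
    rw [e]
    field_simp
  have h3 := ((h2.mul_left π).sub h1).mul_left (4 / (π * α))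
  simp only [sub_sub_cancel] at h3
  simp_rw [← mul_assoc, div_mul_div_cancel₀ (show π * α ≠ 0 by positivity)] at h3
  rw [div_self four_ne_zero] at h3
  simp only [one_mul] at h3
  set u : ℤ → ℝ := fun k => if k ≤ 0 then R (π * α * k / 2) else 0 with hu
  have hinj : Function.Injective fun n : ℕ => -((n : ℤ) + 1) := fun a b h => by
    simpa using h
  have h4 := (h3.summable.comp_injective hinj).hasSum
  have hneg : (fun n : ℕ => u (-((n : ℤ) + 1)))
      = fun n : ℕ => 1 / (Real.sqrt 2 * Real.cosh (π * α * (n + 1) / 2) - 1) := by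
    funext n
    rw [hu]
    simp only
    rw [if_pos (by lia), hR]
    simp only
    rw [← Real.cosh_neg]
    congr 4
    push_cast
    ring
  have h5 : HasSum (fun n : ℕ => u n) (R 0) := by
    have : (fun n : ℕ => u n) = fun n => if n = 0 then R 0 else 0 := by
      funext n
      rcases n with - | n
      · simp [hu]
      · simp only [hu]
        rw [if_neg (by lia), if_neg (by lia)]
    rw [this]
    exact hasSum_ite_eq 0 _
  have h6 := (h5.of_nat_of_neg_add_one h4).unique h3
  rw [show ((u ∘ fun n : ℕ => -((n : ℤ) + 1))) = _ from hneg] at h6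
  have hsq : Real.sqrt 2 - 1 ≠ 0 := by
    have h1 : 1 < Real.sqrt 2 := by
      rw [Real.lt_sqrt] <;> norm_num
    linarith
  have h7 : R 0 = 1 / (Real.sqrt 2 - 1) := by simp [hR]
  rw [h7] at h6
  generalize (∑' n : ℕ, 1 / (Real.sqrt 2 * Real.cosh (π * α * (n + 1) / 2) - 1)) = S at h6 ⊢
  have h8 : π * (1 / Real.tanh (π / (2 * α))) - J = π * α / 4 * (1 / (Real.sqrt 2 - 1) + S) := by
    rw [h6]
    field_simp
  have h9 : π * α / (4 * (Real.sqrt 2 - 1)) = π * α / 4 * (1 / (Real.sqrt 2 - 1)) := by field_simp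
  rw [h9]
  linear_combination -h8
end

section
/- For every α ≠ 0, ∫_0^π sin(ln(2 sin x)/α) / (cosh(x/α) + cos(ln(2 sin x)/α)) dx = 0. -/
open Real

/-- The real and imaginary parts of the tangent of a half argument. -/
lemma complex_tan_half (a b : ℝ) (h : Real.cosh b + Real.cos a ≠ 0) :
    Complex.tan (((a : ℂ) + b * Complex.I) / 2)
      = ((Real.sin a : ℂ) + Real.sinh b * Complex.I) / ((Real.cosh b + Real.cos a : ℝ) : ℂ) := by
  set u : ℂ := ((a : ℂ) + b * Complex.I) / 2 with hu
  set v : ℂ := ((a : ℂ) - b * Complex.I) / 2 with hv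
  have huv : u + v = a := by rw [hu, hv]; ring
  have huv' : u - v = b * Complex.I := by rw [hu, hv]; ring
  have hs : 2 * (Complex.sin u * Complex.cos v) = Real.sin a + Real.sinh b * Complex.I := by
    have h1 := Complex.sin_add u v
    have h2 := Complex.sin_sub u v
    rw [huv] at h1
    rw [huv', Complex.sin_mul_I] at h2
    push_cast
    linear_combination -h1 - h2
  have hc : 2 * (Complex.cos u * Complex.cos v) = ((Real.cosh b + Real.cos a : ℝ) : ℂ) := by
    have h1 := Complex.cos_add u v
    have h2 := Complex.cos_sub u v
    rw [huv] at h1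
    rw [huv', Complex.cos_mul_I] at h2
    push_cast
    linear_combination -h1 - h2
  have hne : ((Real.cosh b + Real.cos a : ℝ) : ℂ) ≠ 0 := by exact_mod_cast h
  have hcu : Complex.cos u ≠ 0 := by
    intro h0
    rw [h0] at hc
    exact hne (by rw [← hc]; ring)
  rw [Complex.tan_eq_sin_div_cos, div_eq_div_iff hcu hne, ← hs, ← hc]
  ring

/-- The arc `x ↦ 1 + i r e^{ix}` of the circle of radius `r` about `1` lies in the disc of
radius `2` about `-1` as long as `r < 4 sin x`. -/
lemma one_add_I_mul_exp_mem_ball {r x : ℝ} (hr : 0 < r) (hx : r < 4 * Real.sin x) :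
    1 + Complex.I * r * Complex.exp (x * Complex.I) ∈ Metric.ball (-1 : ℂ) 2 := by
  rw [Metric.mem_ball, Complex.dist_eq, Complex.exp_mul_I, ← Complex.ofReal_cos,
    ← Complex.ofReal_sin]
  refine lt_of_pow_lt_pow_left₀ 2 (by norm_num) ?_
  rw [← Complex.normSq_eq_norm_sq, Complex.normSq_apply]
  simp [-Complex.ofReal_cos, -Complex.ofReal_sin]
  have h1 : 0 < r * (4 * Real.sin x - r) := mul_pos hr (by linarith)
  have h2 : r ^ 2 * (Real.sin x ^ 2 + Real.cos x ^ 2) = r ^ 2 := by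
    rw [Real.sin_sq_add_cos_sq, mul_one]
  linarith

lemma exp_two_mul_I_eq (x : ℝ) :
    Complex.exp (2 * x * Complex.I)
      = 1 + Complex.I * (2 * Real.sin x : ℝ) * Complex.exp (x * Complex.I) := by
  have : (2 * x * Complex.I : ℂ) = x * Complex.I + x * Complex.I := by ring
  rw [this, Complex.exp_add, Complex.exp_mul_I]
  push_cast
  linear_combination
    Complex.sin_sq_add_cos_sq (x : ℂ) - Complex.sin (x : ℂ) ^ 2 * Complex.I_sq

lemma exp_two_mul_I_mem_ball {x : ℝ} (hx : 0 < Real.sin x) :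
    Complex.exp (2 * x * Complex.I) ∈ Metric.ball (-1 : ℂ) 2 := by
  rw [exp_two_mul_I_eq]
  exact one_add_I_mul_exp_mem_ball (by positivity) (by linarith)

lemma sin_le_sin_of_mem_Icc {δ x : ℝ} (h0 : 0 < δ) (hx : x ∈ Set.Icc δ (π - δ)) :
    Real.sin δ ≤ Real.sin x := by
  obtain ⟨h1, h2⟩ := hx
  rcases le_total x (π / 2) with h | h
  · exact Real.sin_le_sin_of_le_of_le_pi_div_two (by linarith) h h1
  · rw [← Real.sin_pi_sub x]
    exact Real.sin_le_sin_of_le_of_le_pi_div_two (by linarith) (by linarith) (by linarith)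

/-- Approximate mean value property on the unit circle with a small arc about `1` removed, for a
function that is holomorphic on a larger disc touching the unit circle at `1`. -/
lemma norm_integral_sub_le {F : ℂ → ℂ} (hF : DifferentiableOn ℂ F (Metric.ball (-1) 2))
    {δ M : ℝ} (hδ : 0 < δ) (hδ' : δ < π / 2) (hs : 2 * Real.sin δ ≤ 1 / 2)
    (hM : ∀ x ∈ Set.Icc δ (π - δ),
      ‖F (1 + Complex.I * (2 * Real.sin δ : ℝ) * Complex.exp (x * Complex.I))‖ ≤ M) :
    ‖∫ x in δ..(π - δ), (F (Complex.exp (2 * x * Complex.I)) - F 0)‖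
      ≤ (M + ‖F 0‖) * (2 * Real.sin δ) * π := by
  have h0 : Metric.ball (-1 : ℂ) 2 ∈ nhds (0 : ℂ) :=
    Metric.isOpen_ball.mem_nhds (by simp)
  obtain ⟨P, hP⟩ := ((Complex.differentiableOn_dslope h0).2 hF).isExactOn_ball
  have hsδ : 0 < Real.sin δ := Real.sin_pos_of_pos_of_lt_pi hδ (by linarith)
  set r : ℝ := 2 * Real.sin δ with hr
  have hr0 : 0 < r := by positivity
  have hle : δ ≤ π - δ := by linarith
  have hpos : ∀ x ∈ Set.Icc δ (π - δ), 0 < Real.sin x := fun x hx =>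
    hsδ.trans_le (sin_le_sin_of_mem_Icc hδ hx)
  have hd : ∀ x ∈ Set.uIcc δ (π - δ),
      HasDerivAt (fun x : ℝ => P (Complex.exp (2 * x * Complex.I)) / (2 * Complex.I))
        (F (Complex.exp (2 * x * Complex.I)) - F 0) x := by
    intro x hx
    rw [Set.uIcc_of_le hle] at hx
    have h1 : HasDerivAt (fun z : ℂ => Complex.exp (2 * z * Complex.I))
        (Complex.exp (2 * x * Complex.I) * (2 * Complex.I)) (x : ℂ) := by
      have := (((hasDerivAt_id (x : ℂ)).const_mul 2).mul_const Complex.I).cexp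
      simpa using this
    have h2 := ((hP _ (exp_two_mul_I_mem_ball (hpos x hx))).comp (x : ℂ) h1).div_const
      (2 * Complex.I)
    have h3 := h2.comp_ofReal
    refine h3.congr_deriv ?_
    have h4 := sub_smul_dslope F 0 (Complex.exp (2 * x * Complex.I))
    rw [smul_eq_mul, sub_zero] at h4
    rw [← h4]
    field_simp
  have hcont : ContinuousOn (fun x : ℝ => F (Complex.exp (2 * x * Complex.I)) - F 0)
      (Set.uIcc δ (π - δ)) := by
    refine ContinuousOn.sub (hF.continuousOn.comp (by fun_prop) ?_) continuousOn_const
    intro x hx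
    rw [Set.uIcc_of_le hle] at hx
    exact exp_two_mul_I_mem_ball (hpos x hx)
  rw [intervalIntegral.integral_eq_sub_of_hasDerivAt hd hcont.intervalIntegrable]
  have harc : ∀ x ∈ Set.Icc δ (π - δ), HasDerivWithinAt
      (fun x : ℝ => P (1 + Complex.I * r * Complex.exp (x * Complex.I)))
      (dslope F 0 (1 + Complex.I * r * Complex.exp (x * Complex.I))
        * (Complex.I * r * (Complex.exp (x * Complex.I) * Complex.I))) (Set.Icc δ (π - δ)) x := by
    intro x hx
    have h1 : HasDerivAt (fun z : ℂ => 1 + Complex.I * r * Complex.exp (z * Complex.I))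
        (Complex.I * r * (Complex.exp (x * Complex.I) * Complex.I)) (x : ℂ) := by
      have := ((((hasDerivAt_id (x : ℂ)).mul_const Complex.I).cexp).const_mul
        (Complex.I * (r : ℂ))).const_add 1
      simpa using this
    have hmem := one_add_I_mul_exp_mem_ball (x := x) hr0
      (by have := sin_le_sin_of_mem_Icc hδ hx; linarith)
    exact (((hP _ hmem).comp (x : ℂ) h1).comp_ofReal).hasDerivWithinAt
  have hbound : ∀ x ∈ Set.Icc δ (π - δ),
      ‖dslope F 0 (1 + Complex.I * r * Complex.exp (x * Complex.I))
        * (Complex.I * r * (Complex.exp (x * Complex.I) * Complex.I))‖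
        ≤ 2 * (M + ‖F 0‖) * r := by
    intro x hx
    set w : ℂ := 1 + Complex.I * r * Complex.exp (x * Complex.I) with hw
    have hn : ‖Complex.I * r * Complex.exp (x * Complex.I)‖ = r := by
      simp [Complex.norm_exp_ofReal_mul_I, abs_of_pos hr0]
    have hw2 : 1 / 2 ≤ ‖w‖ := by
      have := norm_sub_le w (Complex.I * r * Complex.exp (x * Complex.I))
      rw [hn, hw, add_sub_cancel_right, norm_one, ← hw] at this
      linarith
    have h4 := sub_smul_dslope F 0 w
    rw [smul_eq_mul, sub_zero] at h4
    have h5 : ‖w‖ * ‖dslope F 0 w‖ ≤ M + ‖F 0‖ := by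
      rw [← norm_mul, h4]
      exact (norm_sub_le _ _).trans (by gcongr; exact hM x hx)
    have h6 : ‖dslope F 0 w‖ ≤ 2 * (M + ‖F 0‖) := by
      nlinarith [norm_nonneg (dslope F 0 w)]
    have h7 : ‖Complex.I * r * (Complex.exp (x * Complex.I) * Complex.I)‖ = r := by
      rw [← mul_assoc, norm_mul, hn, Complex.norm_I, mul_one]
    rw [norm_mul, h7]
    gcongr
  have hmv := (convex_Icc δ (π - δ)).norm_image_sub_le_of_norm_hasDerivWithin_le harc hbound
    (Set.left_mem_Icc.2 hle) (Set.right_mem_Icc.2 hle)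
  have e1 := exp_two_mul_I_eq δ
  have e2 := exp_two_mul_I_eq (π - δ)
  rw [Real.sin_pi_sub] at e2
  rw [← hr] at e1 e2
  rw [← sub_div, norm_div, e1, e2]
  have hM0 : 0 ≤ M := (norm_nonneg _).trans (hM δ (Set.left_mem_Icc.2 hle))
  have hnn : 0 ≤ (M + ‖F 0‖) * r := by positivity
  have hlen : ‖π - δ - δ‖ ≤ π := by
    rw [Real.norm_eq_abs, abs_of_nonneg (by linarith)]
    linarith
  have h2I : ‖(2 * Complex.I : ℂ)‖ = 2 := by simp
  rw [h2I, div_le_iff₀ (by norm_num)]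
  refine hmv.trans ?_
  nlinarith

/-- `w ↦ tan ((log (1 - w) + iπ/2) / (2α))`, holomorphic on the half plane `Re w < 1`. -/
noncomputable def tanLog (α : ℝ) (w : ℂ) : ℂ :=
  Complex.tan ((Complex.log (1 - w) + (π / 2 : ℝ) * Complex.I) / (2 * α))

lemma differentiableOn_tanLog {α : ℝ} (hα : α ≠ 0) :
    DifferentiableOn ℂ (tanLog α) (Metric.ball (-1) 2) := by
  intro w hw
  have hre : 0 < (1 - w).re := by
    rw [Metric.mem_ball, Complex.dist_eq] at hw
    have := (Complex.re_le_norm (w - -1)).trans_lt hw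
    simp at this ⊢
    linarith
  have hcos : Complex.cos ((Complex.log (1 - w) + (π / 2 : ℝ) * Complex.I) / (2 * α)) ≠ 0 := by
    intro h
    obtain ⟨k, hk⟩ := Complex.cos_eq_zero_iff.1 h
    have hα' : (2 * α : ℂ) ≠ 0 := by simpa using hα
    rw [div_eq_iff hα'] at hk
    have him := congrArg Complex.im hk
    have hreal : ((2 * k + 1) * π / 2 * (2 * α) : ℂ)
        = (((2 * k + 1) * π / 2 * (2 * α) : ℝ) : ℂ) := by push_cast; ring
    rw [hreal, Complex.ofReal_im, Complex.add_im, Complex.im_ofReal_mul, Complex.I_im,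
      Complex.log_im] at him
    have := (abs_lt.1 (Complex.abs_arg_lt_pi_div_two_iff.2 (Or.inl hre))).1
    linarith
  have hlog : DifferentiableAt ℂ (fun w : ℂ => Complex.log (1 - w)) w :=
    DifferentiableAt.clog (by fun_prop) (Or.inl hre)
  exact (DifferentiableAt.comp w (Complex.differentiableAt_tan.2 hcos)
    ((hlog.add_const _).div_const _)).differentiableWithinAt

lemma tanLog_arc (α : ℝ) (hα : α ≠ 0) {r x : ℝ} (hr : 0 < r) (hx : 0 < x) (hx' : x < π) :
    tanLog α (1 + Complex.I * r * Complex.exp (x * Complex.I))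
      = ((Real.sin (Real.log r / α) : ℂ) + Real.sinh (x / α) * Complex.I)
        / ((Real.cosh (x / α) + Real.cos (Real.log r / α) : ℝ) : ℂ) := by
  have h1 : (1 - (1 + Complex.I * r * Complex.exp (x * Complex.I)) : ℂ)
      = Complex.exp (Real.log r + (x - π / 2 : ℝ) * Complex.I) := by
    have e : ((x - π / 2 : ℝ) * Complex.I : ℂ) = x * Complex.I - π / 2 * Complex.I := by
      push_cast; ring
    rw [Complex.exp_add, ← Complex.ofReal_exp, Real.exp_log hr, e, Complex.exp_sub,
      Complex.exp_pi_div_two_mul_I]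
    rw [mul_div_assoc', eq_div_iff Complex.I_ne_zero]
    linear_combination (-(r : ℂ)) * Complex.exp (x * Complex.I) * Complex.I_sq
  have hpi := Real.pi_pos
  have h2 : Complex.log (1 - (1 + Complex.I * r * Complex.exp (x * Complex.I)))
      = Real.log r + (x - π / 2 : ℝ) * Complex.I := by
    rw [h1, Complex.log_exp]
    · simp only [Complex.add_im, Complex.ofReal_im, Complex.im_ofReal_mul, Complex.I_im]
      linarith
    · simp only [Complex.add_im, Complex.ofReal_im, Complex.im_ofReal_mul, Complex.I_im]
      linarith
  have hne : Real.cosh (x / α) + Real.cos (Real.log r / α) ≠ 0 := by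
    have h3 := Real.one_lt_cosh.2 (div_ne_zero hx.ne' hα)
    have h4 := Real.neg_one_le_cos (Real.log r / α)
    linarith
  rw [← complex_tan_half _ _ hne, tanLog, h2]
  congr 1
  have hα' : (α : ℂ) ≠ 0 := by exact_mod_cast hα
  push_cast
  field_simp
  ring

lemma tanLog_zero_re (α : ℝ) : (tanLog α 0).re = 0 := by
  have h : ((Complex.log (1 - 0) + (π / 2 : ℝ) * Complex.I) / (2 * α) : ℂ)
      = ((π / 2 / (2 * α) : ℝ) : ℂ) * Complex.I := by
    rw [sub_zero, Complex.log_one]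
    push_cast
    ring
  rw [tanLog, h, Complex.tan_mul_I, ← Complex.ofReal_tanh, Complex.re_ofReal_mul, Complex.I_re,
    mul_zero]

lemma norm_tanLog_arc_le {α : ℝ} (hα : α ≠ 0) {r x : ℝ} (hr : 0 < r) (hx : 0 < x) (hx' : x < π)
    (hcos : Real.cos (Real.log r / α) = 1) :
    ‖tanLog α (1 + Complex.I * r * Complex.exp (x * Complex.I))‖ ≤ 1 := by
  have hsin : Real.sin (Real.log r / α) = 0 := by
    have := Real.sin_sq_add_cos_sq (Real.log r / α)
    rw [hcos] at this
    nlinarith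
  have hc := Real.cosh_pos (x / α)
  rw [tanLog_arc α hα hr hx hx', hsin, hcos, norm_div, Complex.norm_real, Real.norm_eq_abs,
    abs_of_pos (by linarith : 0 < Real.cosh (x / α) + 1), div_le_one (by linarith)]
  simp only [Complex.ofReal_zero, zero_add, norm_mul, Complex.norm_real, Complex.norm_I, mul_one,
    Real.norm_eq_abs]
  have := Real.cosh_sq (x / α)
  exact abs_le_of_sq_le_sq (by nlinarith) (by linarith)

/-- Truncated form of the integral, cut off where the logarithm is a period. -/
lemma abs_integral_truncated_le {α : ℝ} (hα : α ≠ 0) {δ : ℝ} (hδ : 0 < δ) (hδ' : δ < π / 2)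
    (hs : 2 * Real.sin δ ≤ 1 / 2) (hcos : Real.cos (Real.log (2 * Real.sin δ) / α) = 1) :
    |∫ x in δ..(π - δ), Real.sin (Real.log (2 * Real.sin x) / α)
        / (Real.cosh (x / α) + Real.cos (Real.log (2 * Real.sin x) / α))|
      ≤ (1 + ‖tanLog α 0‖) * (2 * Real.sin δ) * π := by
  have hsδ : 0 < Real.sin δ := Real.sin_pos_of_pos_of_lt_pi hδ (by linarith)
  have hF := differentiableOn_tanLog hα
  have hle : δ ≤ π - δ := by linarith
  have key := norm_integral_sub_le hF hδ hδ' hs (M := 1) (fun x hx =>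
    norm_tanLog_arc_le hα (by positivity) (by linarith [hx.1]) (by linarith [hx.2]) hcos)
  have hpos : ∀ x ∈ Set.uIcc δ (π - δ), 0 < Real.sin x := fun x hx =>
    hsδ.trans_le (sin_le_sin_of_mem_Icc hδ (by rwa [Set.uIcc_of_le hle] at hx))
  have hint : IntervalIntegrable
      (fun x : ℝ => tanLog α (Complex.exp (2 * x * Complex.I)) - tanLog α 0)
      MeasureTheory.volume δ (π - δ) := by
    refine ContinuousOn.intervalIntegrable (ContinuousOn.sub
      (hF.continuousOn.comp (by fun_prop) ?_) continuousOn_const)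
    exact fun x hx => exp_two_mul_I_mem_ball (hpos x hx)
  refine le_trans (le_of_eq_of_le ?_ (Complex.abs_re_le_norm _)) key
  congr 1
  rw [← Complex.reCLM_apply, ← ContinuousLinearMap.intervalIntegral_comp_comm _ hint]
  refine intervalIntegral.integral_congr fun x hx => ?_
  have hx2 := hx
  rw [Set.uIcc_of_le hle] at hx2
  have := hpos x hx
  simp only [Complex.reCLM_apply, Complex.sub_re, tanLog_zero_re, sub_zero]
  rw [exp_two_mul_I_eq, tanLog_arc α hα (by positivity) (by linarith [hx2.1])
    (by linarith [hx2.2]), Complex.div_ofReal_re]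
  rw [Complex.add_re, Complex.ofReal_re, Complex.re_ofReal_mul, Complex.I_re, mul_zero, add_zero]

open Filter Topology

theorem stmt_17 (α : ℝ) (hα : α ≠ 0) :
    ∫ x in (0:ℝ)..π,
        Real.sin (Real.log (2 * Real.sin x) / α)
          / (Real.cosh (x/α) + Real.cos (Real.log (2 * Real.sin x) / α))
      = 0 := by
  set f : ℝ → ℝ := fun x => Real.sin (Real.log (2 * Real.sin x) / α)
    / (Real.cosh (x/α) + Real.cos (Real.log (2 * Real.sin x) / α)) with hf
  by_cases hint : IntervalIntegrable f MeasureTheory.volume 0 π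
  swap
  · exact intervalIntegral.integral_undef hint
  have hpi := Real.pi_pos
  have hr : Tendsto (fun k : ℕ => Real.exp (-((k : ℝ) * (2 * π * |α|)))) atTop (𝓝 0) := by
    refine Real.tendsto_exp_neg_atTop_nhds_zero.comp ?_
    exact tendsto_natCast_atTop_atTop.atTop_mul_const (by positivity)
  set r : ℕ → ℝ := fun k => Real.exp (-((k : ℝ) * (2 * π * |α|))) with hr_def
  set δ : ℕ → ℝ := fun k => Real.arcsin (r k / 2) with hδ_def
  have hδ : Tendsto δ atTop (𝓝 0) := by
    have h := (Real.continuous_arcsin.tendsto (0 / 2)).comp (hr.div_const 2)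
    rwa [zero_div, Real.arcsin_zero] at h
  have hr0 : ∀ k, 0 < r k := fun k => Real.exp_pos _
  have hcos : ∀ k, Real.cos (Real.log (r k) / α) = 1 := by
    intro k
    rw [hr_def, Real.log_exp, Real.cos_eq_one_iff]
    rcases abs_choice α with h | h
    · exact ⟨-(k : ℤ), by rw [h]; push_cast; field_simp⟩
    · exact ⟨(k : ℤ), by rw [h]; push_cast; field_simp⟩
  have hsmall : ∀ᶠ k in atTop, r k ≤ 1 / 2 := hr.eventually_le_const (by norm_num)
  have hbound : ∀ᶠ k in atTop,
      |∫ x in δ k..(π - δ k), f x| ≤ (1 + ‖tanLog α 0‖) * r k * π := by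
    filter_upwards [hsmall] with k hk
    have hk0 := hr0 k
    have hsin : 2 * Real.sin (δ k) = r k := by
      rw [hδ_def, Real.sin_arcsin (by linarith) (by linarith)]
      ring
    have h := abs_integral_truncated_le hα (δ := δ k) (Real.arcsin_pos.2 (by linarith))
      (Real.arcsin_lt_pi_div_two.2 (by linarith)) (by rw [hsin]; exact hk)
      (by rw [hsin]; exact hcos k)
    rwa [hsin] at h
  have hzero : Tendsto (fun k => ∫ x in δ k..(π - δ k), f x) atTop (𝓝 0) := by
    refine squeeze_zero_norm' hbound ?_
    simpa using (hr.const_mul (1 + ‖tanLog α 0‖)).mul_const π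
  have hmem : ∀ᶠ k in atTop, δ k ∈ Set.uIcc 0 π ∧ π - δ k ∈ Set.uIcc 0 π := by
    filter_upwards [hδ.eventually_le_const hpi] with k hk
    have : 0 ≤ δ k := Real.arcsin_nonneg.2 (by have := hr0 k; linarith)
    rw [Set.uIcc_of_le hpi.le]
    exact ⟨⟨this, hk⟩, by linarith, by linarith⟩
  have hprim := intervalIntegral.continuousOn_primitive_interval' hint Set.left_mem_uIcc
  have h1 : Tendsto (fun k => ∫ x in (0 : ℝ)..δ k, f x) atTop (𝓝 0) := by
    have h := (hprim 0 Set.left_mem_uIcc).tendsto.comp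
      (tendsto_nhdsWithin_iff.2 ⟨hδ, hmem.mono fun _ h => h.1⟩)
    rwa [intervalIntegral.integral_same] at h
  have h2 : Tendsto (fun k => ∫ x in (0 : ℝ)..(π - δ k), f x) atTop
      (𝓝 (∫ x in (0 : ℝ)..π, f x)) := by
    have hδ' : Tendsto (fun k => π - δ k) atTop (𝓝 π) := by
      simpa using hδ.const_sub π
    exact (hprim π Set.right_mem_uIcc).tendsto.comp
      (tendsto_nhdsWithin_iff.2 ⟨hδ', hmem.mono fun _ h => h.2⟩)
  have h3 := h2.sub h1
  rw [sub_zero] at h3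
  refine tendsto_nhds_unique (h3.congr' ?_) hzero
  filter_upwards [hmem] with k hk
  exact intervalIntegral.integral_interval_sub_left
    (hint.mono_set (Set.uIcc_subset_uIcc Set.left_mem_uIcc hk.2))
    (hint.mono_set (Set.uIcc_subset_uIcc Set.left_mem_uIcc hk.1))
end
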